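/- Let m and i be positive integers with m ≥ 3, i ≤ ⌊m/2⌋ and i ≠ ⌊m/2⌋. Then the relative fixity of the squashed distance-i Johnson graph QJ(2m,m,i) equals (1/2)·(1 − 1/(2m−1)) = (m−1)/(2m−1). -/

import Mathlib

/-- A permutation `g` of the vertex set is an automorphism of the (di)graph with arc
relation `A` if `(u,v)` is an arc iff `(g u, g v)` is an arc. -/
def IsDigraphAut {V : Type*} (A : V → V → Prop) (g : Equiv.Perm V) : Prop :=
  ∀ u v : V, A u v ↔ A (g u) (g v)

/-- The fixity of a digraph: the largest number of vertices fixed by a nontrivial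
automorphism (0 if there is none). -/
noncomputable def digraphFixity {V : Type*} (A : V → V → Prop) : ℕ :=
  sSup ((fun g : Equiv.Perm V => Nat.card {v : V // g v = v}) ''
    {g : Equiv.Perm V | IsDigraphAut A g ∧ g ≠ 1})

/-- The equivalence relation identifying an m-subset X of a 2m-element set with its
complement Xᶜ; its classes are the partitions of the 2m-set into two blocks of size m. -/
def blockSetoid (m : ℕ) : Setoid {X : Finset (Fin (2 * m)) // X.card = m} where
  r X Y := Y.val = X.val ∨ Y.val = X.valᶜ
  iseqv := by
    constructor
    · intro X; exact Or.inl rfl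
    · intro X Y h
      rcases h with h | h
      · exact Or.inl h.symm
      · exact Or.inr (by rw [h, compl_compl])
    · intro X Y Z h1 h2
      rcases h1 with h1 | h1 <;> rcases h2 with h2 | h2
      · exact Or.inl (by rw [h2, h1])
      · exact Or.inr (by rw [h2, h1])
      · exact Or.inr (by rw [h2, h1])
      · exact Or.inl (by rw [h2, h1, compl_compl])

/-- The vertex set of the squashed Johnson graph: partitions {X, Xᶜ} of a 2m-element set
into two blocks of size m. -/
def QJVertex (m : ℕ) : Type := Quotient (blockSetoid m)

/-- The adjacency relation of the squashed distance-i Johnson graph QJ(2m,m,i):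
{X, Xᶜ} is adjacent to {Y, Yᶜ} iff min(|X ∩ Y|, m − |X ∩ Y|) = i (this condition does not
depend on the chosen representatives). -/
def squashedJohnsonAdj (m i : ℕ) (P Q : QJVertex m) : Prop :=
  ∃ X Y : {X : Finset (Fin (2 * m)) // X.card = m},
    P = Quotient.mk (blockSetoid m) X ∧ Q = Quotient.mk (blockSetoid m) Y ∧
    min ((X.val ∩ Y.val).card) (m - (X.val ∩ Y.val).card) = i

/-- The number of `i`-subsets of an `(r + n)`-set that meet a given `r`-subset in exactly
`b` elements. -/
def hypergeom (r n i b : ℕ) : ℕ := if b ≤ i then r.choose b * n.choose (i - b) else 0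

theorem hypergeom_eq_zero_of_lt {r n i b : ℕ} (h : r < b) : hypergeom r n i b = 0 := by
  simp [hypergeom, Nat.choose_eq_zero_of_lt h]

theorem hypergeom_rec {r n i : ℕ} (hn : i ≤ n) (b : ℕ) :
    ((b : ℚ) + 1) * (n - i + b + 1) * hypergeom r n i (b + 1) =
      (r - b) * (i - b) * hypergeom r n i b := by
  rcases lt_trichotomy b i with h | rfl | h
  · have h1 : ((r.choose (b + 1) : ℕ) : ℚ) * (b + 1) = r.choose b * (r - b) := by
      have := Nat.choose_succ_right_eq r b
      rcases le_or_gt b r with hb | hb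
      · have h2 := congrArg (Nat.cast (R := ℚ)) this
        push_cast [Nat.cast_sub hb] at h2
        exact h2
      · simp [Nat.choose_eq_zero_of_lt hb, Nat.choose_eq_zero_of_lt (Nat.lt_succ_of_lt hb)]
    have h2 : ((n.choose (i - b) : ℕ) : ℚ) * (i - b) =
        n.choose (i - (b + 1)) * (n - i + b + 1) := by
      have h3 := Nat.choose_succ_right_eq n (i - (b + 1))
      have h4 : i - (b + 1) + 1 = i - b := by omega
      rw [h4] at h3
      have h5 := congrArg (Nat.cast (R := ℚ)) h3
      rw [Nat.cast_mul, Nat.cast_mul, Nat.cast_sub h.le,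
        Nat.cast_sub (show i - (b + 1) ≤ n by omega),
        Nat.cast_sub (show b + 1 ≤ i by omega)] at h5
      push_cast at h5
      rw [h5]; ring
    rw [hypergeom, hypergeom, if_pos (by omega), if_pos h.le]
    push_cast
    linear_combination (n - i + b + 1 : ℚ) * (n.choose (i - (b + 1)) : ℚ) * h1
      - (r - b : ℚ) * (r.choose b : ℚ) * h2
  · simp [hypergeom]
  · simp [hypergeom, not_le.2 h, not_le.2 (Nat.lt_succ_of_lt h)]

section LevelSum

/-- The sum of `h b * h c * F b c` over all `b, c ≤ r` with `b + c = s`. -/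
def levelSum (h : ℕ → ℚ) (r : ℕ) (s : ℤ) (F : ℕ → ℕ → ℚ) : ℚ :=
  ∑ b ∈ Finset.range (r + 1), ∑ c ∈ Finset.range (r + 1),
    if (b : ℤ) + c = s then h b * h c * F b c else 0

variable {h : ℕ → ℚ} {r n i : ℕ}

theorem levelSum_comm (s : ℤ) (F : ℕ → ℕ → ℚ) :
    levelSum h r s (fun b c => F c b) = levelSum h r s F := by
  unfold levelSum
  rw [Finset.sum_comm]
  refine Finset.sum_congr rfl fun b _ => Finset.sum_congr rfl fun c _ => ?_
  simp only [add_comm (c : ℤ), mul_comm (h c)]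

theorem levelSum_add (s : ℤ) (F G : ℕ → ℕ → ℚ) :
    levelSum h r s (fun b c => F b c + G b c) = levelSum h r s F + levelSum h r s G := by
  unfold levelSum
  simp only [← Finset.sum_add_distrib]
  refine Finset.sum_congr rfl fun b _ => Finset.sum_congr rfl fun c _ => ?_
  split_ifs <;> ring

theorem levelSum_mul_left (s : ℤ) (k : ℚ) (F : ℕ → ℕ → ℚ) :
    levelSum h r s (fun b c => k * F b c) = k * levelSum h r s F := by
  unfold levelSum
  simp only [Finset.mul_sum]
  refine Finset.sum_congr rfl fun b _ => Finset.sum_congr rfl fun c _ => ?_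
  split_ifs <;> ring

theorem levelSum_congr {s : ℤ} {F G : ℕ → ℕ → ℚ}
    (H : ∀ b c : ℕ, (b : ℚ) + c = s → F b c = G b c) :
    levelSum h r s F = levelSum h r s G := by
  unfold levelSum
  refine Finset.sum_congr rfl fun b _ => Finset.sum_congr rfl fun c _ => ?_
  split_ifs with hs
  · rw [H b c (by exact_mod_cast hs)]
  · rfl

theorem levelSum_nonneg (hpos : ∀ b, 0 ≤ h b) {s : ℤ} {F : ℕ → ℕ → ℚ}
    (H : ∀ b ≤ r, ∀ c ≤ r, 0 ≤ F b c) : 0 ≤ levelSum h r s F := by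
  unfold levelSum
  refine Finset.sum_nonneg fun b hb => Finset.sum_nonneg fun c hc => ?_
  split_ifs
  · exact mul_nonneg (mul_nonneg (hpos b) (hpos c))
      (H b (Finset.mem_range_succ_iff.1 hb) c (Finset.mem_range_succ_iff.1 hc))
  · exact le_rfl

theorem levelSum_nonpos (hpos : ∀ b, 0 ≤ h b) {s : ℤ} {F : ℕ → ℕ → ℚ}
    (H : ∀ b ≤ r, ∀ c ≤ r, F b c ≤ 0) : levelSum h r s F ≤ 0 := by
  have := levelSum_nonneg (s := s) (F := fun b c => (-1) * F b c) hpos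
    (fun b hb c hc => by have := H b hb c hc; linarith)
  rw [levelSum_mul_left] at this
  linarith

theorem sum_shift (hrec : ∀ b : ℕ, ((b : ℚ) + 1) * (n - i + b + 1) * h (b + 1) =
      (r - b) * (i - b) * h b) (φ : ℕ → ℚ) :
    ∑ b ∈ Finset.range (r + 1), h b * (b * (n - i + b) * φ b) =
      ∑ b ∈ Finset.range (r + 1), h b * ((r - b) * (i - b) * φ (b + 1)) := by
  rw [Finset.sum_range_succ', Finset.sum_range_succ]
  simp only [Nat.cast_zero, zero_mul, mul_zero, sub_self]
  congr 1
  refine Finset.sum_congr rfl fun b _ => ?_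
  push_cast
  linear_combination φ (b + 1) * hrec b

theorem levelSum_shift (hrec : ∀ b : ℕ, ((b : ℚ) + 1) * (n - i + b + 1) * h (b + 1) =
      (r - b) * (i - b) * h b) (s : ℤ) (G : ℕ → ℕ → ℚ) :
    levelSum h r s (fun b c => c * (n - i + c) * G b c) =
      levelSum h r (s - 1) (fun b c => (r - c) * (i - c) * G b (c + 1)) := by
  unfold levelSum
  refine Finset.sum_congr rfl fun b _ => ?_
  have := sum_shift hrec (fun c => if (b : ℤ) + c = s then h b * G b c else 0)
  convert this using 1 <;> refine Finset.sum_congr rfl fun c _ => ?_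
  · split_ifs <;> ring
  · have : ((b : ℤ) + c = s - 1) ↔ ((b : ℤ) + ((c + 1 : ℕ) : ℤ) = s) := by push_cast; omega
    simp only [this]
    split_ifs <;> ring

theorem levelSum_mul_sub_nonpos (hpos : ∀ b, 0 ≤ h b) (hn : i < n)
    (hrec : ∀ b : ℕ, ((b : ℚ) + 1) * (n - i + b + 1) * h (b + 1) =
      (r - b) * (i - b) * h b) (s : ℤ) :
    levelSum h r s (fun b c => c * (r - b) * (c - b - 1)) ≤ 0 := by
  have hn' : (i : ℚ) < n := by exact_mod_cast hn
  have e1 : levelSum h r s (fun b c => c * (r - b) * (c - b - 1)) =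
      levelSum h r (s - 1)
        (fun b c => (r - c) * (i - c) * ((r - b) * (c - b) / (n - i + c + 1))) := by
    have := levelSum_shift hrec s
      (fun b c => ((r : ℚ) - b) * (c - b - 1) / (n - i + c))
    rw [levelSum_congr (G := fun b c => (c : ℚ) * (n - i + c) *
      (((r : ℚ) - b) * (c - b - 1) / (n - i + c))), this]
    · refine levelSum_congr fun b c _ => ?_
      push_cast
      ring
    · intro b c _
      have : (n : ℚ) - i + c ≠ 0 := by
        have : (0 : ℚ) ≤ c := Nat.cast_nonneg c
        linarith
      field_simp
  have e2 := levelSum_comm (h := h) (r := r) (s - 1)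
    (fun b c => ((r : ℚ) - c) * (i - c) * ((r - b) * (c - b) / (n - i + c + 1)))
  have e3 : levelSum h r (s - 1) (fun b c =>
      ((r : ℚ) - c) * (i - c) * ((r - b) * (c - b) / (n - i + c + 1)) +
      ((r : ℚ) - b) * (i - b) * ((r - c) * (b - c) / (n - i + b + 1))) ≤ 0 := by
    refine levelSum_nonpos hpos fun b hb c hc => ?_
    have hb' : (b : ℚ) ≤ r := by exact_mod_cast hb
    have hc' : (c : ℚ) ≤ r := by exact_mod_cast hc
    have pb : (0 : ℚ) < n - i + b + 1 := by
      have : (0 : ℚ) ≤ b := Nat.cast_nonneg b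
      linarith
    have pc : (0 : ℚ) < n - i + c + 1 := by
      have : (0 : ℚ) ≤ c := Nat.cast_nonneg c
      linarith
    have : ((r : ℚ) - c) * (i - c) * ((r - b) * (c - b) / (n - i + c + 1)) +
      ((r : ℚ) - b) * (i - b) * ((r - c) * (b - c) / (n - i + b + 1)) =
      - (((r - b) * (r - c) * (c - b) ^ 2 * (n + 1)) / ((n - i + b + 1) * (n - i + c + 1))) := by
      field_simp
      ring
    rw [this, neg_nonpos]
    have h1 : (0 : ℚ) ≤ r - b := by linarith
    have h2 : (0 : ℚ) ≤ r - c := by linarith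
    positivity
  rw [levelSum_add, e2] at e3
  rw [e1]
  linarith

theorem levelSum_sq_le (hpos : ∀ b, 0 ≤ h b) (hn : i < n)
    (hrec : ∀ b : ℕ, ((b : ℚ) + 1) * (n - i + b + 1) * h (b + 1) =
      (r - b) * (i - b) * h b) (s : ℤ) :
    levelSum h r s (fun b c => r * (c - b) ^ 2) ≤
      levelSum h r s (fun b c => b * (r - c) + c * (r - b)) := by
  have e1 := levelSum_mul_sub_nonpos hpos hn hrec s
  have e2 := levelSum_comm (h := h) (r := r) s (fun b c => (c : ℚ) * (r - b) * (c - b - 1))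
  have e3 : levelSum h r s (fun b c => r * (c - b) ^ 2) =
      levelSum h r s (fun b c => (c * (r - b) * (c - b - 1) + b * (r - c) * (b - c - 1)) +
        (b * (r - c) + c * (r - b))) :=
    levelSum_congr fun b c _ => by ring
  rw [e3, levelSum_add, levelSum_add, e2]
  linarith

theorem levelSum_mul_le (hpos : ∀ b, 0 ≤ h b) (hn : i < n)
    (hrec : ∀ b : ℕ, ((b : ℚ) + 1) * (n - i + b + 1) * h (b + 1) =
      (r - b) * (i - b) * h b) (s : ℤ) :
    2 * (2 * n - 2 * i + s) * levelSum h r s (fun b c => b * c) ≤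
      (2 * i - s + 2) * levelSum h r (s - 1) (fun b c => b * (r - c) + c * (r - b)) := by
  have e1 := levelSum_shift hrec s (fun b _ => b)
  have e2 := levelSum_comm (h := h) (r := r) s (fun b c => (c : ℚ) * (n - i + c) * b)
  have e3 := levelSum_comm (h := h) (r := r) (s - 1) (fun b c => ((r : ℚ) - c) * (i - c) * b)
  have e4 : (2 * n - 2 * i + s) * levelSum h r s (fun b c => b * c) =
      levelSum h r s (fun b c => c * (n - i + c) * b + b * (n - i + b) * c) := by
    rw [← levelSum_mul_left]
    exact levelSum_congr fun b c hs => by rw [← hs]; ring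
  have e5 : levelSum h r (s - 1) (fun b c => (r - c) * (i - c) * b + (r - b) * (i - b) * c) =
      levelSum h r (s - 1) (fun b c => (2 * i - s + 1) / 2 * (b * (r - c) + c * (r - b)) +
        1 / 2 * (r * (c - b) ^ 2)) :=
    levelSum_congr fun b c hs => by
      have : (s : ℚ) = b + c + 1 := by push_cast at hs; linarith
      rw [this]; ring
  rw [levelSum_add, levelSum_add, levelSum_mul_left, levelSum_mul_left] at e5
  rw [levelSum_add] at e4
  have := levelSum_sq_le hpos hn hrec (s - 1)
  linarith

theorem levelSum_sub_mul_le (hpos : ∀ b, 0 ≤ h b) (hn : i < n)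
    (hrec : ∀ b : ℕ, ((b : ℚ) + 1) * (n - i + b + 1) * h (b + 1) =
      (r - b) * (i - b) * h b) (s : ℤ) :
    2 * (2 * i - s) * levelSum h r s (fun b c => (r - b) * (r - c)) ≤
      (2 * n - 2 * i + s + 2) *
        levelSum h r (s + 1) (fun b c => b * (r - c) + c * (r - b)) := by
  have e1 := levelSum_shift hrec (s + 1) (fun b _ => (r : ℚ) - b)
  rw [add_sub_cancel_right] at e1
  have e2 := levelSum_comm (h := h) (r := r) s (fun b c => ((r : ℚ) - c) * (i - c) * (r - b))
  have e3 := levelSum_comm (h := h) (r := r) (s + 1)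
    (fun b c => (c : ℚ) * (n - i + c) * (r - b))
  have e4 : (2 * i - s) * levelSum h r s (fun b c => (r - b) * (r - c)) =
      levelSum h r s (fun b c => (r - c) * (i - c) * (r - b) + (r - b) * (i - b) * (r - c)) := by
    rw [← levelSum_mul_left]
    exact levelSum_congr fun b c hs => by rw [← hs]; ring
  have e5 : levelSum h r (s + 1) (fun b c => c * (n - i + c) * (r - b) +
        b * (n - i + b) * (r - c)) =
      levelSum h r (s + 1) (fun b c =>
        (2 * n - 2 * i + s + 1) / 2 * (b * (r - c) + c * (r - b)) +
        1 / 2 * (r * (c - b) ^ 2)) :=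
    levelSum_congr fun b c hs => by
      have : (s : ℚ) = b + c - 1 := by push_cast at hs; linarith
      rw [this]; ring
  rw [levelSum_add, levelSum_add, levelSum_mul_left, levelSum_mul_left] at e5
  rw [levelSum_add] at e4
  have := levelSum_sq_le hpos hn hrec (s + 1)
  linarith

theorem sum_levelSum_le (hpos : ∀ b, 0 ≤ h b) (L : Finset ℤ) {F : ℕ → ℕ → ℚ}
    (H : ∀ b ≤ r, ∀ c ≤ r, 0 ≤ F b c) :
    ∑ s ∈ L, levelSum h r s F ≤
      ∑ b ∈ Finset.range (r + 1), ∑ c ∈ Finset.range (r + 1), h b * h c * F b c := by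
  unfold levelSum
  rw [Finset.sum_comm]
  refine Finset.sum_le_sum fun b hb => ?_
  rw [Finset.sum_comm]
  refine Finset.sum_le_sum fun c hc => ?_
  rw [Finset.sum_ite_eq]
  split_ifs
  · exact le_rfl
  · exact mul_nonneg (mul_nonneg (hpos b) (hpos c))
      (H b (Finset.mem_range_succ_iff.1 hb) c (Finset.mem_range_succ_iff.1 hc))

theorem levelSum_pos (hpos : ∀ b, 0 ≤ h b) {F : ℕ → ℕ → ℚ}
    (H : ∀ b ≤ r, ∀ c ≤ r, 0 ≤ F b c) {b c : ℕ} (hb : b ≤ r) (hc : c ≤ r) {s : ℤ}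
    (hs : (b : ℤ) + c = s) (hb0 : 0 < h b) (hc0 : 0 < h c) (hF : 0 < F b c) :
    0 < levelSum h r s F := by
  have key : ∀ b ≤ r, ∀ c ≤ r, 0 ≤ if (b : ℤ) + c = s then h b * h c * F b c else 0 := by
    intro b hb c hc
    split_ifs
    · exact mul_nonneg (mul_nonneg (hpos b) (hpos c)) (H b hb c hc)
    · exact le_rfl
  unfold levelSum
  refine Finset.sum_pos' (fun b hb => Finset.sum_nonneg fun c hc =>
    key b (Finset.mem_range_succ_iff.1 hb) c (Finset.mem_range_succ_iff.1 hc))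
    ⟨b, Finset.mem_range_succ_iff.2 hb, ?_⟩
  refine Finset.sum_pos' (fun c hc => key b hb c (Finset.mem_range_succ_iff.1 hc))
    ⟨c, Finset.mem_range_succ_iff.2 hc, ?_⟩
  rw [if_pos hs]
  positivity

theorem sq_mul_levelSum_one (s : ℤ) :
    (r : ℚ) ^ 2 * levelSum h r s (fun _ _ => 1) =
      levelSum h r s (fun b c => b * c) + levelSum h r s (fun b c => (r - b) * (r - c)) +
      levelSum h r s (fun b c => b * (r - c) + c * (r - b)) := by
  rw [← levelSum_add, ← levelSum_add, ← levelSum_mul_left]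
  exact levelSum_congr fun b c _ => by ring

theorem sq_mul_levelSum_lt (hpos : ∀ b, 0 ≤ h b)
    (hrec : ∀ b : ℕ, ((b : ℚ) + 1) * (n - i + b + 1) * h (b + 1) =
      (r - b) * (i - b) * h b) (h0 : 0 < h 0) (h1 : 0 < h 1) (hi : 1 ≤ i) {d : ℕ}
    (hd : 2 ≤ d) (hid : 2 * i + d = n + r) (hr : 2 ≤ r) (hrn : r ≤ n) (hdn : d = 2 → 9 ≤ n) :
    (r : ℚ) ^ 2 * (levelSum h r r (fun _ _ => 1) + levelSum h r (r - d) (fun _ _ => 1)) <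
      ∑ b ∈ Finset.range (r + 1), ∑ c ∈ Finset.range (r + 1),
        h b * h c * (b * (r - c) + c * (r - b)) := by
  have hin : i < n := by omega
  have hidq : (2 : ℚ) * i + d = n + r := by exact_mod_cast hid
  have hrnq : (r : ℚ) ≤ n := by exact_mod_cast hrn
  have hrq : (2 : ℚ) ≤ r := by exact_mod_cast hr
  have hnonneg : ∀ b ≤ r, ∀ c ≤ r, (0 : ℚ) ≤ b * (r - c) + c * (r - b) := by
    intro b hb c hc
    have hb' : (0 : ℚ) ≤ r - b := sub_nonneg.2 (by exact_mod_cast hb)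
    have hc' : (0 : ℚ) ≤ r - c := sub_nonneg.2 (by exact_mod_cast hc)
    positivity
  set S : ℚ := ∑ b ∈ Finset.range (r + 1), ∑ c ∈ Finset.range (r + 1),
        h b * h c * (b * (r - c) + c * (r - b)) with hS
  set N : ℤ → ℚ := fun s => levelSum h r s (fun b c => b * (r - c) + c * (r - b)) with hN
  have hN0 : ∀ s, 0 ≤ N s := fun s => levelSum_nonneg hpos hnonneg
  have hsub : ∀ L : Finset ℤ, ∑ s ∈ L, N s ≤ S := fun L => sum_levelSum_le hpos L hnonneg
  -- some level other than `r` and `r - d` contributes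
  have hM : N r + N (r - d) < S := by
    obtain ⟨s, hs1, hs2, hs⟩ : ∃ s : ℤ, s ≠ r ∧ s ≠ r - d ∧ 0 < N s := by
      by_cases hrd : r = d + 1
      · refine ⟨2, by omega, by omega, ?_⟩
        refine levelSum_pos hpos hnonneg (b := 1) (c := 1) (by omega) (by omega)
          (by norm_num) h1 h1 ?_
        push_cast; linarith
      · refine ⟨1, by omega, by omega, ?_⟩
        refine levelSum_pos hpos hnonneg (b := 1) (c := 0) (by omega) (by omega)
          (by norm_num) h1 h0 ?_
        push_cast; linarith
    have := hsub {(r : ℤ), (r : ℤ) - d, s}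
    rw [Finset.sum_insert (by simp; omega), Finset.sum_insert (by simp; omega),
      Finset.sum_singleton] at this
    linarith
  have eq0 : levelSum h r r (fun b c => (r - b) * (r - c)) =
      levelSum h r r (fun b c => (b : ℚ) * c) :=
    levelSum_congr fun b c hs => by
      have hs' : (b : ℚ) + c = r := by exact_mod_cast hs
      linear_combination (-r : ℚ) * hs'
  have p0 := levelSum_mul_le hpos hin hrec (r : ℤ)
  have m0 := levelSum_sub_mul_le hpos hin hrec (r : ℤ)
  have pd := levelSum_mul_le hpos hin hrec ((r : ℤ) - d)
  have md := levelSum_sub_mul_le hpos hin hrec ((r : ℤ) - d)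
  have t0 := sq_mul_levelSum_one (h := h) (r := r) (r : ℤ)
  have td := sq_mul_levelSum_one (h := h) (r := r) ((r : ℤ) - d)
  change _ ≤ _ * N _ at p0 m0 pd md
  change _ = _ + _ + N _ at t0 td
  rw [eq0] at t0 m0
  push_cast at p0 m0 pd md
  set a := levelSum h r r (fun b c => (b : ℚ) * c) with ha
  set p := levelSum h r (r - d) (fun b c => (b : ℚ) * c) with hp
  set q := levelSum h r (r - d) (fun b c => ((r : ℚ) - b) * (r - c)) with hq
  have hn3 : (3 : ℚ) ≤ n := by
    have : 3 ≤ n := by omega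
    exact_mod_cast this
  have hnp : (0 : ℚ) < n := by linarith
  have hp0 : 2 * n * p ≤ (n + 2) * N (r - d - 1) := by
    refine (le_of_eq ?_).trans (pd.trans (le_of_eq ?_))
    · linear_combination (2 * p) * hidq
    · linear_combination N (r - d - 1) * hidq
  have hq0 : 2 * n * q ≤ (n + 2) * N (r - d + 1) := by
    refine (le_of_eq ?_).trans (md.trans (le_of_eq ?_))
    · linear_combination (-2 * q) * hidq
    · linear_combination -N (r - d + 1) * hidq
  have ha1 : 2 * (n + d) * a ≤ (n - d + 2) * N (r - 1) := by
    refine (le_of_eq ?_).trans (p0.trans (le_of_eq ?_))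
    · linear_combination (2 * a) * hidq
    · linear_combination N (r - 1) * hidq
  have ha2 : 2 * (n - d) * a ≤ (n + d + 2) * N (r + 1) := by
    refine (le_of_eq ?_).trans (m0.trans (le_of_eq ?_))
    · linear_combination (-2 * a) * hidq
    · linear_combination -N (r + 1) * hidq
  have k1 := hN0 (r - 1)
  have k2 := hN0 (r - d - 1)
  have k3 := hN0 (r - d + 1)
  have k4 := hN0 (r + 1)
  have scale : ∀ x y κ : ℚ, 0 ≤ y → (n + 2) ≤ 2 * n * κ → 2 * n * x ≤ (n + 2) * y →
      x ≤ κ * y := by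
    intro x y κ hy hκ hx
    have h3 := mul_le_mul_of_nonneg_right hκ hy
    have h4 : 2 * n * x ≤ 2 * n * (κ * y) := by linarith
    exact le_of_mul_le_mul_left h4 (by linarith)
  rw [mul_add, t0, td]
  rcases hd.lt_or_eq with hd3 | hd2
  · have hd3q : (3 : ℚ) ≤ d := by exact_mod_cast hd3
    have hQ := hsub {(r : ℤ), (r : ℤ) - d, (r : ℤ) - 1, (r : ℤ) - d - 1, (r : ℤ) - d + 1}
    rw [Finset.sum_insert (by simp; omega), Finset.sum_insert (by simp; omega),
      Finset.sum_insert (by simp; omega), Finset.sum_insert (by simp; omega),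
      Finset.sum_singleton] at hQ
    have hp1 := scale p _ (5 / 6) k2 (by linarith) hp0
    have hq1 := scale q _ (5 / 6) k3 (by linarith) hq0
    rcases k1.eq_or_lt with k1 | k1
    · rw [← k1, mul_zero] at ha1
      have : a ≤ 0 := nonpos_of_mul_nonpos_right ha1 (by linarith)
      by_cases hz : N (r - d - 1) + N (r - d + 1) = 0 <;> [skip; have hz := lt_of_le_of_ne
        (add_nonneg k2 k3) (Ne.symm hz)] <;> linarith
    · have h5 : (n - d + 2) * N (r - 1) < (n + d) * N (r - 1) :=
        mul_lt_mul_of_pos_right (by linarith) k1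
      have h6 : 2 * a < N (r - 1) := by
        refine lt_of_mul_lt_mul_left (a := (n + d : ℚ)) ?_ (by linarith)
        linarith
      linarith
  · have hn9 : (9 : ℚ) ≤ n := by exact_mod_cast hdn hd2.symm
    have hdq : (d : ℚ) = 2 := by exact_mod_cast hd2.symm
    have e1 : (r : ℤ) - d + 1 = r - 1 := by omega
    rw [e1] at hq0
    have hQ := hsub {(r : ℤ), (r : ℤ) - d, (r : ℤ) - 1, (r : ℤ) - d - 1, (r : ℤ) + 1}
    rw [Finset.sum_insert (by simp; omega), Finset.sum_insert (by simp; omega),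
      Finset.sum_insert (by simp; omega), Finset.sum_insert (by simp; omega),
      Finset.sum_singleton] at hQ
    have hp1 := scale p _ (11 / 18) k2 (by linarith) hp0
    have hq1 := scale q _ (11 / 18) k1 (by linarith) hq0
    rw [hdq] at ha1 ha2
    have ha3 : 2 * a ≤ 54 / 143 * N (r - 1) + N (r + 1) := by
      have h5 : 6 * n * N (r - 1) ≤ (n + 4) * (n + 2) * (54 / 143 * N (r - 1)) := by
        have : 0 ≤ ((n : ℚ) - 9) * (54 * n - 48) * N (r - 1) :=
          mul_nonneg (mul_nonneg (by linarith) (by linarith)) k1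
        linarith
      have h6 : (n + 4) * (n + 2) * (2 * a) ≤
          (n + 4) * (n + 2) * (54 / 143 * N (r - 1) + N (r + 1)) := by
        have h7 := mul_le_mul_of_nonneg_left ha2 (show (0 : ℚ) ≤ n + 2 by linarith)
        linarith
      refine le_of_mul_le_mul_left h6 (by positivity)
    have hz : 0 ≤ N (r - 1) + N (r - d - 1) := add_nonneg k1 k2
    rcases hz.eq_or_lt with hz | hz
    · have k0 : N (r - 1) = 0 := by linarith
      rw [k0, mul_zero] at ha1
      have : a ≤ 0 := nonpos_of_mul_nonpos_right ha1 (by linarith)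
      linarith
    · linarith

end LevelSum

theorem sum_range_hypergeom (r n i : ℕ) :
    ∑ b ∈ Finset.range (r + 1), hypergeom r n i b = (r + n).choose i := by
  rw [Nat.add_choose_eq, Finset.Nat.sum_antidiagonal_eq_sum_range_succ_mk]
  have h1 : ∑ b ∈ Finset.range (r + 1), hypergeom r n i b =
      ∑ b ∈ Finset.range (r + i + 1), hypergeom r n i b := by
    refine Finset.sum_subset (by simp) fun b _ hb => ?_
    exact hypergeom_eq_zero_of_lt (by simpa using hb)
  rw [h1]
  symm
  rw [Finset.sum_congr rfl (g := fun b => hypergeom r n i b)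
    (fun b hb => by simp only [Finset.mem_range] at hb; rw [hypergeom, if_pos (by omega)])]
  refine Finset.sum_subset (by simp) fun b _ hb => ?_
  simp only [Finset.mem_range] at hb
  rw [hypergeom, if_neg (by omega)]

theorem sum_range_mul_hypergeom (r n i : ℕ) :
    ∑ b ∈ Finset.range (r + 1 + 1), hypergeom (r + 1) n (i + 1) b * b =
      (r + 1) * (r + n).choose i := by
  rw [Finset.sum_range_succ', mul_zero, add_zero, ← sum_range_hypergeom, Finset.mul_sum]
  refine Finset.sum_congr rfl fun b _ => ?_
  simp only [hypergeom, Nat.add_le_add_iff_right, Nat.add_sub_add_right]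
  split_ifs
  · rw [mul_right_comm, ← Nat.add_one_mul_choose_eq, mul_assoc]
  · simp

theorem sum_range_sub_mul_hypergeom (r n i : ℕ) :
    ∑ b ∈ Finset.range (r + 1 + 1), hypergeom (r + 1) n i b * (r + 1 - b) =
      (r + 1) * (r + n).choose i := by
  rw [Finset.sum_range_succ, Nat.sub_self, mul_zero, add_zero, ← sum_range_hypergeom,
    Finset.mul_sum]
  refine Finset.sum_congr rfl fun b hb => ?_
  simp only [hypergeom]
  split_ifs
  · have := Nat.choose_mul_succ_eq r b
    rw [mul_right_comm, ← this]
    ring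
  · simp

/-- The number of common neighbours of two vertices of `QJ(2m, m, i)`, `m = r + n`, which have
representatives meeting in `n` elements. -/
def commonCount (r n i : ℕ) : ℕ :=
  ∑ b ∈ Finset.range (r + 1), ∑ c ∈ Finset.range (r + 1),
    if b + c = r ∨ b + c + (r + n - 2 * i) = r then hypergeom r n i b * hypergeom r n i c else 0

theorem commonCount_one {n i : ℕ} (hi : 1 ≤ i) (hn : 2 * i + 1 ≤ n) :
    commonCount 1 n i = 2 * (n.choose (i - 1) * n.choose i) := by
  have h1 : ¬ (1 + n - 2 * i = 1) := by omega
  have h2 : ¬ (1 + n - 2 * i = 0) := by omega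
  have h3 : ¬ (2 + (1 + n - 2 * i) = 1) := by omega
  simp [commonCount, Finset.sum_range_succ, hypergeom, hi, h1, h2, h3]
  ring

theorem commonCount_lt {r n i : ℕ} (hi : 1 ≤ i) (hin : 2 * i + 2 ≤ n + r) (hr : 2 ≤ r)
    (hrn : r ≤ n) (h9 : 2 * i + 2 = n + r → 9 ≤ n) :
    commonCount r n i < 2 * ((r - 1 + n).choose (i - 1) * (r - 1 + n).choose i) := by
  obtain ⟨d, hd⟩ : ∃ d, 2 * i + d = n + r := ⟨n + r - 2 * i, by omega⟩
  have key := sq_mul_levelSum_lt (h := fun b => (hypergeom r n i b : ℚ)) (r := r) (n := n) (i := i)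
    (d := d) (fun b => Nat.cast_nonneg _) (hypergeom_rec (by omega))
    (by
      have := Nat.choose_pos (n := n) (k := i) (by omega)
      simpa [hypergeom] using this)
    (by
      have := Nat.choose_pos (n := n) (k := i - 1) (by omega)
      simp only [hypergeom, if_pos hi, Nat.choose_one_right]
      exact_mod_cast Nat.mul_pos (by omega) this) hi (by omega) hd hr hrn
    (fun h => h9 (by omega))
  have e1 : ∑ b ∈ Finset.range (r + 1), ∑ c ∈ Finset.range (r + 1),
        (hypergeom r n i b : ℚ) * hypergeom r n i c * (b * (r - c) + c * (r - b)) =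
      r ^ 2 * (2 * ((r - 1 + n).choose (i - 1) * (r - 1 + n).choose i)) := by
    obtain ⟨r, rfl⟩ : ∃ k, r = k + 1 := ⟨r - 1, by omega⟩
    obtain ⟨i, rfl⟩ : ∃ k, i = k + 1 := ⟨i - 1, by omega⟩
    have f1 := congrArg (Nat.cast (R := ℚ)) (sum_range_mul_hypergeom r n i)
    have f2 := congrArg (Nat.cast (R := ℚ)) (sum_range_sub_mul_hypergeom r n (i + 1))
    rw [Nat.cast_sum] at f1 f2
    rw [Finset.sum_congr rfl (g := fun b : ℕ =>
      (hypergeom (r + 1) n (i + 1) b : ℚ) * ((r + 1 : ℕ) - b)) (fun b hb => by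
        rw [Nat.cast_mul, Nat.cast_sub (Finset.mem_range_succ_iff.1 hb)])] at f2
    simp only [Nat.cast_mul] at f1
    have f3 : ∑ b ∈ Finset.range (r + 1 + 1), ∑ c ∈ Finset.range (r + 1 + 1),
        (hypergeom (r + 1) n (i + 1) b : ℚ) * hypergeom (r + 1) n (i + 1) c *
          (b * ((r + 1 : ℕ) - c) + c * ((r + 1 : ℕ) - b)) =
      2 * ((∑ b ∈ Finset.range (r + 1 + 1), (hypergeom (r + 1) n (i + 1) b : ℚ) * b) *
        ∑ c ∈ Finset.range (r + 1 + 1), (hypergeom (r + 1) n (i + 1) c : ℚ) * ((r + 1 : ℕ) - c)) := by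
      rw [two_mul]
      nth_rewrite 2 [mul_comm]
      simp only [Finset.sum_mul_sum, ← Finset.sum_add_distrib]
      refine Finset.sum_congr rfl fun b _ => Finset.sum_congr rfl fun c _ => ?_
      ring
    rw [f3, f1, f2]
    simp only [Nat.add_sub_cancel]
    push_cast
    ring
  have e2 : (commonCount r n i : ℚ) =
      levelSum (fun b => (hypergeom r n i b : ℚ)) r r (fun _ _ => 1) +
      levelSum (fun b => (hypergeom r n i b : ℚ)) r (r - d) (fun _ _ => 1) := by
    unfold commonCount levelSum
    rw [Nat.cast_sum, ← Finset.sum_add_distrib]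
    refine Finset.sum_congr rfl fun b _ => ?_
    rw [Nat.cast_sum, ← Finset.sum_add_distrib]
    refine Finset.sum_congr rfl fun c _ => ?_
    have g1 : ((b : ℤ) + c = r) ↔ b + c = r := by omega
    have g2 : ((b : ℤ) + c = r - d) ↔ b + c + (r + n - 2 * i) = r := by omega
    simp only [g1, g2]
    by_cases c1 : b + c = r
    · have c2 : ¬ b + c + (r + n - 2 * i) = r := by omega
      simp [c1]
      omega
    · simp [c1]
  rw [e1, ← e2] at key
  have hr2 : (0 : ℚ) < r ^ 2 := by positivity
  have := lt_of_mul_lt_mul_left key hr2.le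
  exact_mod_cast this

theorem commonCount_ne {r n i : ℕ} (hi : 1 ≤ i) (hin : 2 * i + 2 ≤ n + r) (hr : 2 ≤ r)
    (hrn : r ≤ n) :
    commonCount r n i ≠ 2 * ((r - 1 + n).choose (i - 1) * (r - 1 + n).choose i) := by
  by_cases h9 : 2 * i + 2 = n + r → 9 ≤ n
  · exact (commonCount_lt hi hin hr hrn h9).ne
  · push Not at h9
    obtain ⟨h1, h2⟩ := h9
    have : ∀ n < 9, ∀ r ≤ n, 2 ≤ r → (n + r) % 2 = 0 → commonCount r n ((n + r) / 2 - 1) ≠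
        2 * ((r - 1 + n).choose ((n + r) / 2 - 1 - 1) * (r - 1 + n).choose ((n + r) / 2 - 1)) := by
      decide +kernel
    obtain rfl : i = (n + r) / 2 - 1 := by omega
    exact this n h2 r hrn hr (by omega)

section SquashedJohnson

open Finset

open Equiv (swap swap_apply_def)

variable {m i : ℕ}

/-- The `m`-subsets of a `2m`-element set, i.e. the blocks of the vertices of `QJ(2m, m, i)`. -/
abbrev HalfSet (m : ℕ) : Type := {X : Finset (Fin (2 * m)) // X.card = m}

/-- The partition `{X, Xᶜ}`. -/
def HalfSet.toVertex {m : ℕ} (X : HalfSet m) : QJVertex m := Quotient.mk (blockSetoid m) X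

namespace HalfSet

theorem toVertex_surjective : Function.Surjective (toVertex : HalfSet m → QJVertex m) :=
  Quotient.mk_surjective

theorem toVertex_eq_iff {X Y : HalfSet m} :
    X.toVertex = Y.toVertex ↔ Y.1 = X.1 ∨ Y.1 = X.1ᶜ :=
  Quotient.eq (r := blockSetoid m)

theorem card_compl_eq (X : HalfSet m) : (X.1ᶜ).card = m := by
  rw [card_compl, Fintype.card_fin, X.2]; omega

/-- The complementary block. -/
def compl (X : HalfSet m) : HalfSet m := ⟨X.1ᶜ, X.card_compl_eq⟩

theorem toVertex_compl (X : HalfSet m) : X.compl.toVertex = X.toVertex :=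
  toVertex_eq_iff.2 (Or.inr (compl_compl X.1).symm)

theorem card_inter_compl_add (X Y : HalfSet m) : (X.1 ∩ Y.1ᶜ).card + (X.1 ∩ Y.1).card = m := by
  rw [← sdiff_eq_inter_compl, card_sdiff_add_card_inter, X.2]

theorem card_compl_inter_add (X Y : HalfSet m) : (X.1ᶜ ∩ Y.1).card + (X.1 ∩ Y.1).card = m := by
  rw [inter_comm, inter_comm X.1, card_inter_compl_add]

theorem card_inter_le (X Y : HalfSet m) : (X.1 ∩ Y.1).card ≤ m :=
  (card_le_card inter_subset_left).trans X.2.le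

theorem adj_toVertex_iff {X Y : HalfSet m} :
    squashedJohnsonAdj m i X.toVertex Y.toVertex ↔
      min (X.1 ∩ Y.1).card (m - (X.1 ∩ Y.1).card) = i := by
  constructor
  · rintro ⟨X', Y', hX, hY, h⟩
    rw [← h]
    have hX' := toVertex_eq_iff.1 hX
    have hY' := toVertex_eq_iff.1 hY
    have h1 := X.card_inter_compl_add Y
    have h2 := X.card_compl_inter_add Y
    have h3 := X.compl.card_inter_compl_add Y
    change (X.1ᶜ ∩ Y.1ᶜ).card + (X.1ᶜ ∩ Y.1).card = m at h3
    rcases hX' with hX' | hX' <;> rcases hY' with hY' | hY' <;> rw [hX', hY'] <;> omega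
  · exact fun h => ⟨X, Y, rfl, rfl, h⟩

end HalfSet

open HalfSet

theorem card_filter_powersetCard_inter {α : Type*} [DecidableEq α] {A X : Finset α} {r n : ℕ}
    (hAX : A ⊆ X) (hA : A.card = r) (hX : X.card = r + n) (i b : ℕ) :
    ((powersetCard i X).filter (fun U => (U ∩ A).card = b)).card = hypergeom r n i b := by
  unfold hypergeom
  split_ifs with hb
  · rw [← hA, ← card_powersetCard b A,
      show n = (X \ A).card by rw [card_sdiff_of_subset hAX]; omega,
      ← card_powersetCard (i - b) (X \ A), ← card_product]
    refine card_nbij' (fun U => (U ∩ A, U \ A)) (fun P => P.1 ∪ P.2) ?_ ?_ ?_ ?_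
    · intro U hU
      simp only [mem_coe, mem_filter, mem_powersetCard, mem_product] at hU ⊢
      have := card_sdiff_add_card_inter U A
      exact ⟨⟨inter_subset_right, hU.2⟩, sdiff_subset_sdiff hU.1.1 le_rfl, by omega⟩
    · rintro ⟨P, Q⟩ h
      simp only [mem_coe, mem_filter, mem_powersetCard, mem_product] at h ⊢
      obtain ⟨⟨h1, h2⟩, h3, h4⟩ := h
      have hdis : Disjoint P Q := disjoint_of_subset_left h1
        (disjoint_of_subset_right h3 disjoint_sdiff)
      refine ⟨⟨union_subset (h1.trans hAX) (h3.trans sdiff_subset), ?_⟩, ?_⟩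
      · rw [card_union_of_disjoint hdis]; omega
      · rw [union_inter_distrib_right, inter_eq_left.2 h1, disjoint_iff_inter_eq_empty.1
          (disjoint_of_subset_left h3 sdiff_disjoint), union_empty, h2]
    · intro U _
      ext z; simp; tauto
    · rintro ⟨P, Q⟩ h
      simp only [mem_coe, mem_powersetCard, mem_product] at h
      obtain ⟨⟨h1, -⟩, h3, -⟩ := h
      ext z
      · have := @h1 z; have := @h3 z; simp at *; tauto
      · have := @h1 z; have := @h3 z; simp at *; tauto
  · rw [card_eq_zero, filter_eq_empty_iff]
    intro U hU h
    have := card_le_card (inter_subset_left (s₁ := U) (s₂ := A))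
    rw [(mem_powersetCard.1 hU).2] at this
    omega

namespace HalfSet

theorem natCard_common_eq_card_filter (hi : 2 * i < m) (X Y : HalfSet m) :
    Nat.card {R : QJVertex m // squashedJohnsonAdj m i X.toVertex R ∧
      squashedJohnsonAdj m i Y.toVertex R} =
    ((univ : Finset (Finset (Fin (2 * m)))).filter (fun Z => Z.card = m ∧ (X.1 ∩ Z).card = i ∧
      ((Y.1 ∩ Z).card = i ∨ (Y.1 ∩ Z).card = m - i))).card := by
  rw [← Fintype.card_subtype, ← Nat.card_eq_fintype_card]
  symm
  refine Nat.card_congr (Equiv.ofBijective (fun Z => ⟨toVertex ⟨Z.1, Z.2.1⟩, ?_⟩) ⟨?_, ?_⟩)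
  · obtain ⟨Z, h1, h2, h3⟩ := Z
    simp only [adj_toVertex_iff]
    omega
  · rintro ⟨Z, h1, h2, h3⟩ ⟨Z', h1', h2', h3'⟩ h
    simp only [Subtype.mk.injEq] at h ⊢
    rcases toVertex_eq_iff.1 h with h | h
    · exact h.symm
    · have := X.card_inter_compl_add ⟨Z, h1⟩
      simp only at h this
      rw [← h] at this
      omega
  · rintro ⟨R, h⟩
    obtain ⟨Z, rfl⟩ := toVertex_surjective R
    simp only [adj_toVertex_iff] at h
    have h1 := X.card_inter_compl_add Z
    have h2 := Y.card_inter_compl_add Z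
    by_cases hZ : (X.1 ∩ Z.1).card = i
    · exact ⟨⟨Z.1, Z.2, hZ, by omega⟩, rfl⟩
    · exact ⟨⟨Z.1ᶜ, Z.card_compl_eq, by omega, by omega⟩, Subtype.ext Z.toVertex_compl⟩

theorem natCard_common (hi : 2 * i < m) {r n : ℕ} (hm : r + n = m) (X Y : HalfSet m)
    (hXY : (X.1 ∩ Y.1).card = n) :
    Nat.card {R : QJVertex m // squashedJohnsonAdj m i X.toVertex R ∧
      squashedJohnsonAdj m i Y.toVertex R} = commonCount r n i := by
  have hA : (X.1 \ Y.1).card = r := by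
    have := card_sdiff_add_card_inter X.1 Y.1
    have := X.2; omega
  have hB : (Y.1 \ X.1).card = r := by
    have := card_sdiff_add_card_inter Y.1 X.1
    rw [inter_comm] at this
    have := Y.2; omega
  have hBX : Y.1 \ X.1 ⊆ X.1ᶜ := fun z hz => mem_compl.2 (mem_sdiff.1 hz).2
  rw [natCard_common_eq_card_filter hi]
  trans (((powersetCard i X.1) ×ˢ (powersetCard i X.1ᶜ)).filter (fun P =>
    (P.1 ∩ (X.1 \ Y.1)).card + (P.2 ∩ (Y.1 \ X.1)).card = r ∨
    (P.1 ∩ (X.1 \ Y.1)).card + (P.2 ∩ (Y.1 \ X.1)).card + (r + n - 2 * i) = r)).card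
  · have key : ∀ U ⊆ X.1, ∀ W ⊆ X.1ᶜ,
        (Y.1 ∩ (U ∪ (X.1ᶜ \ W))).card + (U ∩ (X.1 \ Y.1)).card + (W ∩ (Y.1 \ X.1)).card =
          U.card + r := by
      intro U hU W hW
      have e1 : Y.1 ∩ (U ∪ (X.1ᶜ \ W)) = (Y.1 ∩ U) ∪ ((Y.1 \ X.1) \ W) := by
        ext z; simp; tauto
      have e2 : Disjoint (Y.1 ∩ U) ((Y.1 \ X.1) \ W) := by
        rw [disjoint_left]
        intro z hz hz'
        exact (mem_sdiff.1 (mem_sdiff.1 hz').1).2 (hU (mem_inter.1 hz).2)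
      have e3 : U ∩ (X.1 \ Y.1) = U \ Y.1 := by
        ext z; have := @hU z; simp; tauto
      have h1 := card_sdiff_add_card_inter U Y.1
      have h2 := card_sdiff_add_card_inter (Y.1 \ X.1) W
      rw [e1, card_union_of_disjoint e2, e3, inter_comm Y.1, inter_comm W]
      omega
    refine card_nbij' (fun Z => (X.1 ∩ Z, X.1ᶜ \ Z)) (fun P => P.1 ∪ (X.1ᶜ \ P.2)) ?_ ?_ ?_ ?_
    · intro Z hZ
      simp only [mem_coe, mem_filter, mem_univ, true_and, mem_product, mem_powersetCard] at hZ ⊢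
      obtain ⟨h1, h2, h3⟩ := hZ
      have h4 := X.card_compl_inter_add ⟨Z, h1⟩
      have h5 := card_sdiff_add_card_inter X.1ᶜ Z
      have h6 := key (X.1 ∩ Z) inter_subset_left (X.1ᶜ \ Z) sdiff_subset
      have h7 : X.1 ∩ Z ∪ (X.1ᶜ \ (X.1ᶜ \ Z)) = Z := by ext z; simp; tauto
      rw [h7] at h6
      rw [X.card_compl_eq] at h5
      simp only at h4
      exact ⟨⟨⟨inter_subset_left, h2⟩, sdiff_subset, by omega⟩, by omega⟩
    · rintro ⟨U, W⟩ h
      simp only [mem_coe, mem_filter, mem_univ, true_and, mem_product, mem_powersetCard] at h ⊢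
      obtain ⟨⟨⟨h1, h2⟩, h3, h4⟩, h5⟩ := h
      have h6 := key U h1 W h3
      have h7 : X.1 ∩ (U ∪ (X.1ᶜ \ W)) = U := by
        ext z; have := @h1 z; simp; tauto
      have h8 : Disjoint U (X.1ᶜ \ W) := by
        rw [disjoint_left]
        intro z hz hz'
        exact (mem_compl.1 (mem_sdiff.1 hz').1) (h1 hz)
      have h9 := card_sdiff_of_subset h3
      rw [X.card_compl_eq] at h9
      have h10 := card_le_card (inter_subset_left (s₁ := U) (s₂ := X.1 \ Y.1))
      rw [h7, card_union_of_disjoint h8]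
      exact ⟨by omega, h2, by omega⟩
    · intro Z _
      ext z; simp; tauto
    · rintro ⟨U, W⟩ h
      simp only [mem_coe, mem_filter, mem_product, mem_powersetCard] at h
      obtain ⟨⟨⟨h1, h2⟩, h3, h4⟩, h5⟩ := h
      ext z
      · have := @h1 z; simp; tauto
      · have := @h1 z; have := @h3 z; simp at *; tauto
  · rw [commonCount, card_filter, sum_product]
    have fib : ∀ (A V : Finset (Fin (2 * m))), A ⊆ V → A.card = r → V.card = r + n →
        ∀ φ : ℕ → ℕ, ∑ U ∈ powersetCard i V, φ (U ∩ A).card =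
          ∑ b ∈ range (r + 1), hypergeom r n i b * φ b := by
      intro A V hAV hA hV φ
      have maps : ∀ U ∈ powersetCard i V, (U ∩ A).card ∈ range (r + 1) := fun U _ =>
        mem_range_succ_iff.2 ((card_le_card inter_subset_right).trans hA.le)
      rw [← sum_fiberwise_of_maps_to maps]
      refine sum_congr rfl fun b _ => ?_
      rw [← card_filter_powersetCard_inter hAV hA hV]
      exact sum_const_nat fun U hU => by rw [(mem_filter.1 hU).2]
    have hX : X.1.card = r + n := X.2.trans hm.symm
    have hX' : X.1ᶜ.card = r + n := X.card_compl_eq.trans hm.symm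
    have s1 : ∀ a : ℕ, ∑ W ∈ powersetCard i X.1ᶜ, (if a + (W ∩ (Y.1 \ X.1)).card = r ∨
        a + (W ∩ (Y.1 \ X.1)).card + (r + n - 2 * i) = r then 1 else 0) =
        ∑ c ∈ range (r + 1), hypergeom r n i c *
          (if a + c = r ∨ a + c + (r + n - 2 * i) = r then 1 else 0) := fun a =>
      fib _ _ hBX hB hX' (fun c => if a + c = r ∨ a + c + (r + n - 2 * i) = r then 1 else 0)
    simp only [s1]
    rw [fib _ _ sdiff_subset hA hX (fun b => ∑ c ∈ range (r + 1), hypergeom r n i c *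
          (if b + c = r ∨ b + c + (r + n - 2 * i) = r then 1 else 0))]
    refine sum_congr rfl fun b _ => ?_
    rw [mul_sum]
    refine sum_congr rfl fun c _ => ?_
    split_ifs <;> simp

theorem exists_representatives (P Q : QJVertex m) :
    ∃ X Y : HalfSet m, X.toVertex = P ∧ Y.toVertex = Q ∧ m ≤ 2 * (X.1 ∩ Y.1).card := by
  obtain ⟨X, rfl⟩ := toVertex_surjective P
  obtain ⟨Y, rfl⟩ := toVertex_surjective Q
  by_cases h : m ≤ 2 * (X.1 ∩ Y.1).card
  · exact ⟨X, Y, rfl, rfl, h⟩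
  · refine ⟨X, Y.compl, rfl, Y.toVertex_compl, ?_⟩
    have := X.card_inter_compl_add Y
    change m ≤ 2 * (X.1 ∩ Y.1ᶜ).card
    omega

end HalfSet

theorem squashedJohnsonAdj_one_iff {m i : ℕ} (hi : 1 ≤ i) (him : 2 * i + 2 ≤ m)
    (P Q : QJVertex m) :
    squashedJohnsonAdj m 1 P Q ↔ P ≠ Q ∧
      Nat.card {R : QJVertex m // squashedJohnsonAdj m i P R ∧ squashedJohnsonAdj m i Q R} =
        2 * ((m - 1).choose (i - 1) * (m - 1).choose i) := by
  obtain ⟨X, Y, rfl, rfl, h⟩ := exists_representatives P Q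
  have hle := X.card_inter_le Y
  obtain ⟨r, hr⟩ : ∃ r, r + (X.1 ∩ Y.1).card = m := ⟨m - (X.1 ∩ Y.1).card, by omega⟩
  rw [natCard_common (by omega) hr X Y rfl, adj_toVertex_iff]
  rcases (show r = 0 ∨ r = 1 ∨ 2 ≤ r by omega) with rfl | rfl | hr2
  · have e : X.1 = Y.1 := by
      have h1 : X.1 ∩ Y.1 = X.1 := eq_of_subset_of_card_le inter_subset_left (by rw [X.2]; omega)
      have h2 : X.1 ∩ Y.1 = Y.1 := eq_of_subset_of_card_le inter_subset_right (by rw [Y.2]; omega)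
      rw [← h1, h2]
    constructor
    · intro h; omega
    · intro h; exact absurd (toVertex_eq_iff.2 (Or.inl e.symm)) h.1
  · have hn : m - 1 = (X.1 ∩ Y.1).card := by omega
    constructor
    · intro _
      refine ⟨fun e => ?_, ?_⟩
      · rcases toVertex_eq_iff.1 e with e | e
        · rw [e, inter_self, X.2] at hr; omega
        · rw [e, inter_compl, card_empty] at h; omega
      · rw [hn]
        exact commonCount_one hi (by omega)
    · intro _; omega
  · constructor
    · intro h; omega
    · intro h
      have h3 := commonCount_ne (n := (X.1 ∩ Y.1).card) hi (by omega) hr2 (by omega)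
      rw [show r - 1 + (X.1 ∩ Y.1).card = m - 1 by omega] at h3
      exact absurd h.2 h3

theorem IsDigraphAut.squashedJohnsonAdj_one {m i : ℕ} (hi : 1 ≤ i) (him : 2 * i + 2 ≤ m)
    {g : Equiv.Perm (QJVertex m)} (hg : IsDigraphAut (squashedJohnsonAdj m i) g) :
    IsDigraphAut (squashedJohnsonAdj m 1) g := by
  intro P Q
  rw [squashedJohnsonAdj_one_iff hi him, squashedJohnsonAdj_one_iff hi him, g.injective.ne_iff]
  rw [Nat.card_congr (g.subtypeEquiv (p := fun R => squashedJohnsonAdj m i P R ∧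
    squashedJohnsonAdj m i Q R) (q := fun R => squashedJohnsonAdj m i (g P) R ∧
    squashedJohnsonAdj m i (g Q) R) fun R => by rw [hg P R, hg Q R])]

namespace HalfSet

/-- The image of a block under a permutation of the underlying set. -/
def mapPerm (σ : Equiv.Perm (Fin (2 * m))) (X : HalfSet m) : HalfSet m :=
  ⟨X.1.map σ.toEmbedding, by rw [card_map, X.2]⟩

theorem mem_mapPerm {σ : Equiv.Perm (Fin (2 * m))} {X : HalfSet m} {z : Fin (2 * m)} :
    z ∈ (X.mapPerm σ).1 ↔ σ.symm z ∈ X.1 :=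
  mem_map_equiv

theorem mapPerm_mul (σ τ : Equiv.Perm (Fin (2 * m))) (X : HalfSet m) :
    X.mapPerm (σ * τ) = (X.mapPerm τ).mapPerm σ := by
  ext z
  simp only [mem_mapPerm]
  rfl

theorem mapPerm_one (X : HalfSet m) : X.mapPerm 1 = X := by
  ext z
  rw [mem_mapPerm]
  rfl

theorem card_mapPerm_inter (σ : Equiv.Perm (Fin (2 * m))) (X Y : HalfSet m) :
    ((X.mapPerm σ).1 ∩ (Y.mapPerm σ).1).card = (X.1 ∩ Y.1).card := by
  simp only [mapPerm]
  rw [← map_inter, card_map]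

theorem toVertex_mapPerm_congr (σ : Equiv.Perm (Fin (2 * m))) {X Y : HalfSet m}
    (h : X.toVertex = Y.toVertex) : (X.mapPerm σ).toVertex = (Y.mapPerm σ).toVertex := by
  rw [toVertex_eq_iff] at h ⊢
  refine h.imp (fun h => ?_) (fun h => ?_) <;> ext z <;> simp [mem_mapPerm, h]

end HalfSet

instance : MulAction (Equiv.Perm (Fin (2 * m))) (QJVertex m) where
  smul σ := Quotient.lift (fun X : HalfSet m => (X.mapPerm σ).toVertex)
    fun _ _ h => toVertex_mapPerm_congr σ (Quotient.sound h)
  one_smul P := by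
    obtain ⟨X, rfl⟩ := toVertex_surjective P
    exact congrArg toVertex X.mapPerm_one
  mul_smul σ τ P := by
    obtain ⟨X, rfl⟩ := toVertex_surjective P
    exact congrArg toVertex (X.mapPerm_mul σ τ)

/-- The action of the symmetric group on the vertices of `QJ(2m, m, i)`. -/
def permVertex : Equiv.Perm (Fin (2 * m)) →* Equiv.Perm (QJVertex m) :=
  MulAction.toPermHom _ _

theorem permVertex_toVertex (σ : Equiv.Perm (Fin (2 * m))) (X : HalfSet m) :
    permVertex σ X.toVertex = (X.mapPerm σ).toVertex :=
  rfl

theorem isDigraphAut_permVertex (i : ℕ) (σ : Equiv.Perm (Fin (2 * m))) :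
    IsDigraphAut (squashedJohnsonAdj m i) (permVertex σ) := by
  intro P Q
  obtain ⟨X, rfl⟩ := toVertex_surjective P
  obtain ⟨Y, rfl⟩ := toVertex_surjective Q
  rw [permVertex_toVertex, permVertex_toVertex, adj_toVertex_iff, adj_toVertex_iff,
    card_mapPerm_inter]

theorem squashedJohnsonAdj_symm {P Q : QJVertex m} (h : squashedJohnsonAdj m i P Q) :
    squashedJohnsonAdj m i Q P := by
  obtain ⟨X, Y, hX, hY, h⟩ := h
  exact ⟨Y, X, hY, hX, by rwa [inter_comm]⟩

theorem squashedJohnsonAdj_zero_iff {P Q : QJVertex m} :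
    squashedJohnsonAdj m 0 P Q ↔ P = Q := by
  obtain ⟨X, rfl⟩ := toVertex_surjective P
  obtain ⟨Y, rfl⟩ := toVertex_surjective Q
  rw [adj_toVertex_iff, toVertex_eq_iff]
  have hle := X.card_inter_le Y
  constructor
  · intro h
    rcases (show (X.1 ∩ Y.1).card = m ∨ (X.1 ∩ Y.1).card = 0 by omega) with h | h
    · left
      rw [← eq_of_subset_of_card_le (inter_subset_left (s₁ := X.1) (s₂ := Y.1))
        (by rw [X.2, h])]
      exact (eq_of_subset_of_card_le (inter_subset_right (s₁ := X.1) (s₂ := Y.1))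
        (by rw [Y.2, h])).symm
    · right
      refine eq_of_subset_of_card_le (fun z hz => mem_compl.2 fun hz' => ?_)
        (by rw [X.card_compl_eq, Y.2])
      have := mem_inter.2 ⟨hz', hz⟩
      rw [card_eq_zero.1 h] at this
      simp at this
  · rintro (h | h)
    · rw [h, inter_self, X.2]; omega
    · rw [h, inter_compl, card_empty]; omega

namespace HalfSet

theorem permVertex_swap_eq {X : HalfSet m} {x y : Fin (2 * m)} (h : x ∈ X.1 ↔ y ∈ X.1) :
    permVertex (swap x y) X.toVertex = X.toVertex := by
  rw [permVertex_toVertex]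
  congr 1
  ext z
  rw [mem_mapPerm, Equiv.symm_swap, swap_apply_def]
  split_ifs with h1 h2
  · rw [h1, h]
  · rw [h2, h]
  · rfl

variable {X : HalfSet m} {x y x' y' : Fin (2 * m)}

theorem card_mapPerm_swap_inter (hx : x ∈ X.1) (hy : y ∉ X.1) (hx' : x' ∈ X.1)
    (hy' : y' ∉ X.1) : ((X.mapPerm (swap x y)).1 ∩ (X.mapPerm (swap x' y')).1).card +
      ((if x = x' then 0 else 1) + (if y = y' then 0 else 1)) = m := by
  have h := card_sdiff_add_card_inter (X.mapPerm (swap x y)).1 (X.mapPerm (swap x' y')).1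
  rw [(X.mapPerm (swap x y)).2] at h
  have hxy : x' ≠ y := fun e => hy (e ▸ hx')
  have e : (X.mapPerm (swap x y)).1 \ (X.mapPerm (swap x' y')).1 =
      (if x = x' then ∅ else {x'}) ∪ (if y = y' then ∅ else {y}) := by
    ext z
    simp only [mem_sdiff, mem_mapPerm, Equiv.symm_swap, swap_apply_def]
    grind
  have hc : ((if x = x' then ∅ else {x'}) ∪ (if y = y' then ∅ else {y}) : Finset _).card =
      (if x = x' then 0 else 1) + (if y = y' then 0 else 1) := by
    split_ifs <;> simp [card_pair hxy]
  rw [e, hc] at h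
  exact (add_comm _ _).trans h

theorem permVertex_swap_eq_iff (hm : 3 ≤ m) (hx : x ∈ X.1) (hy : y ∉ X.1) (hx' : x' ∈ X.1)
    (hy' : y' ∉ X.1) : permVertex (swap x y) X.toVertex = permVertex (swap x' y') X.toVertex ↔
      x = x' ∧ y = y' := by
  have h := card_mapPerm_swap_inter hx hy hx' hy'
  rw [← squashedJohnsonAdj_zero_iff, permVertex_toVertex, permVertex_toVertex, adj_toVertex_iff]
  generalize ((X.mapPerm (swap x y)).1 ∩ (X.mapPerm (swap x' y')).1).card = c at h ⊢
  by_cases h1 : x = x' <;> by_cases h2 : y = y' <;> simp [h1, h2] at h ⊢ <;> omega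

theorem adj_permVertex_swap_iff (hm : 4 ≤ m) (hx : x ∈ X.1) (hy : y ∉ X.1) (hx' : x' ∈ X.1)
    (hy' : y' ∉ X.1) : squashedJohnsonAdj m 1 (permVertex (swap x y) X.toVertex)
        (permVertex (swap x' y') X.toVertex) ↔ (x = x' ∧ y ≠ y') ∨ (x ≠ x' ∧ y = y') := by
  have h := card_mapPerm_swap_inter hx hy hx' hy'
  rw [permVertex_toVertex, permVertex_toVertex, adj_toVertex_iff]
  generalize ((X.mapPerm (swap x y)).1 ∩ (X.mapPerm (swap x' y')).1).card = c at h ⊢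
  by_cases h1 : x = x' <;> by_cases h2 : y = y' <;> simp [h1, h2] at h ⊢ <;> omega

theorem adj_toVertex_permVertex_swap (hm : 2 ≤ m) (hx : x ∈ X.1) (hy : y ∉ X.1) :
    squashedJohnsonAdj m 1 X.toVertex (permVertex (swap x y) X.toVertex) := by
  have h := card_sdiff_add_card_inter X.1 (X.mapPerm (swap x y)).1
  have e : X.1 \ (X.mapPerm (swap x y)).1 = {x} := by
    ext z
    simp only [mem_sdiff, mem_mapPerm, Equiv.symm_swap, swap_apply_def]
    grind
  rw [e, X.2, card_singleton] at h
  rw [permVertex_toVertex, adj_toVertex_iff]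
  omega

theorem exists_swap_of_adj {Q : QJVertex m} (h : squashedJohnsonAdj m 1 X.toVertex Q) :
    ∃ x ∈ X.1, ∃ y ∉ X.1, permVertex (swap x y) X.toVertex = Q := by
  obtain ⟨Y, hY, hc⟩ : ∃ Y : HalfSet m, Y.toVertex = Q ∧ (X.1 ∩ Y.1).card + 1 = m := by
    obtain ⟨Y, rfl⟩ := toVertex_surjective Q
    rw [adj_toVertex_iff] at h
    by_cases hc : (X.1 ∩ Y.1).card + 1 = m
    · exact ⟨Y, rfl, hc⟩
    · refine ⟨Y.compl, Y.toVertex_compl, ?_⟩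
      have := X.card_inter_compl_add Y
      change (X.1 ∩ Y.1ᶜ).card + 1 = m
      omega
  have h1 := card_sdiff_add_card_inter X.1 Y.1
  have h2 := card_sdiff_add_card_inter Y.1 X.1
  rw [inter_comm Y.1] at h2
  have h3 := X.2
  have h4 := Y.2
  obtain ⟨x, hx⟩ := card_eq_one.1 (show (X.1 \ Y.1).card = 1 by omega)
  obtain ⟨y, hy⟩ := card_eq_one.1 (show (Y.1 \ X.1).card = 1 by omega)
  simp only [Finset.ext_iff, mem_sdiff, mem_singleton] at hx hy
  refine ⟨x, ((hx x).2 rfl).1, y, ((hy y).2 rfl).2, ?_⟩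
  rw [← hY, permVertex_toVertex]
  congr 1
  ext z
  rw [mem_mapPerm, Equiv.symm_swap, swap_apply_def]
  grind

theorem exists_permVertex_eq (P Q : QJVertex m) :
    ∃ σ : Equiv.Perm (Fin (2 * m)), permVertex σ P = Q := by
  obtain ⟨X, rfl⟩ := toVertex_surjective P
  obtain ⟨Y, rfl⟩ := toVertex_surjective Q
  let e : {z // z ∈ X.1} ≃ {z // z ∈ Y.1} := Finset.equivOfCardEq (X.2.trans Y.2.symm)
  refine ⟨e.extendSubtype, ?_⟩
  rw [permVertex_toVertex]
  congr 1
  refine Subtype.ext (eq_of_subset_of_card_le (fun z hz => ?_) (Y.2.trans (X.mapPerm _).2.symm).le)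
  rw [mem_mapPerm] at hz
  simpa using e.extendSubtype_mem _ hz

end HalfSet

/-- A family of pairs any two of which agree in some coordinate is constant in one coordinate. -/
theorem forall_fst_eq_or_forall_snd_eq {ι γ δ : Type*} (h : ι → γ × δ)
    (hh : ∀ b b', (h b).1 = (h b').1 ∨ (h b).2 = (h b').2) :
    (∀ b b', (h b).1 = (h b').1) ∨ (∀ b b', (h b).2 = (h b').2) := by
  by_contra! hc
  obtain ⟨⟨b, b', h1⟩, c, c', h2⟩ := hc
  grind

theorem exists_prod_map_of_rows {α β γ δ : Type*} [Nontrivial γ] [Nonempty α]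
    [Nonempty β] {f : α × β → γ × δ} (hf : Function.Bijective f)
    (hadj : ∀ p q, p.1 = q.1 ∨ p.2 = q.2 → (f p).1 = (f q).1 ∨ (f p).2 = (f q).2)
    (hrow : ∀ a b b', (f (a, b)).1 = (f (a, b')).1) :
    ∃ (u : α → γ) (v : β → δ), Function.Injective u ∧ Function.Injective v ∧
      ∀ a b, f (a, b) = (u a, v b) := by
  have hcol : ∀ b a a', (f (a, b)).2 = (f (a', b)).2 := by
    intro b
    refine (forall_fst_eq_or_forall_snd_eq (fun a => f (a, b)) fun a a' =>
      hadj _ _ (Or.inr rfl)).resolve_left fun hc => ?_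
    obtain ⟨c, c', hne⟩ := exists_pair_ne γ
    have d := (f (Classical.arbitrary _)).2
    obtain ⟨⟨a1, b1⟩, h1⟩ := hf.2 (c, d)
    obtain ⟨⟨a2, b2⟩, h2⟩ := hf.2 (c', d)
    have e1 := hrow a1 b1 b
    have e2 := hrow a2 b2 b
    have e3 := hc a1 a2
    simp only [h1, h2] at e1 e2 e3
    exact hne (by rw [e1, e2, e3])
  obtain ⟨a₀⟩ := ‹Nonempty α›
  obtain ⟨b₀⟩ := ‹Nonempty β›
  have key : ∀ a b, f (a, b) = ((f (a, b₀)).1, (f (a₀, b)).2) := fun a b =>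
    Prod.ext (hrow a b b₀) (hcol b a a₀)
  refine ⟨fun a => (f (a, b₀)).1, fun b => (f (a₀, b)).2, fun a a' h => ?_, fun b b' h => ?_, key⟩
  · have := hf.1 (show f (a, b₀) = f (a', b₀) from Prod.ext h (hcol _ _ _))
    exact congrArg Prod.fst this
  · have := hf.1 (show f (a₀, b) = f (a₀, b') from Prod.ext (hrow _ _ _) h)
    exact congrArg Prod.snd this

/-- Automorphisms of the `m × m` rook graph. -/
theorem exists_prod_map_or_swap {α β γ δ : Type*} [Finite α] [Finite β] [Finite γ] [Finite δ]
    [Nontrivial α] {f : α × β → γ × δ} (hf : Function.Injective f)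
    (hβ : Nat.card β = Nat.card α) (hγ : Nat.card γ = Nat.card α) (hδ : Nat.card δ = Nat.card α)
    (hadj : ∀ p q, p.1 = q.1 ∨ p.2 = q.2 → (f p).1 = (f q).1 ∨ (f p).2 = (f q).2) :
    (∃ (u : α → γ) (v : β → δ), Function.Injective u ∧ Function.Injective v ∧
      ∀ a b, f (a, b) = (u a, v b)) ∨
    (∃ (u : α → δ) (v : β → γ), Function.Injective u ∧ Function.Injective v ∧
      ∀ a b, f (a, b) = (v b, u a)) := by
  have hα : 1 < Nat.card α := Finite.one_lt_card
  have : Nontrivial γ := Finite.one_lt_card_iff_nontrivial.1 (hγ ▸ hα)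
  have : Nontrivial δ := Finite.one_lt_card_iff_nontrivial.1 (hδ ▸ hα)
  have : Nontrivial β := Finite.one_lt_card_iff_nontrivial.1 (hβ ▸ hα)
  have hbij : Function.Bijective f :=
    hf.bijective_of_nat_card_le (by rw [Nat.card_prod, Nat.card_prod, hβ, hγ, hδ])
  have hrow : ∀ a, (∀ b b', (f (a, b)).1 = (f (a, b')).1) ∨
      (∀ b b', (f (a, b)).2 = (f (a, b')).2) := fun a =>
    forall_fst_eq_or_forall_snd_eq (fun b => f (a, b)) fun b b' => hadj _ _ (Or.inl rfl)
  by_cases hall : ∀ a b b', (f (a, b)).1 = (f (a, b')).1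
  · exact Or.inl (exists_prod_map_of_rows hbij hadj hall)
  · right
    push Not at hall
    obtain ⟨a₀, b₀, b₁, hne⟩ := hall
    have h0 := (hrow a₀).resolve_left fun h => hne (h _ _)
    have hall : ∀ a b b', (f (a, b)).2 = (f (a, b')).2 := by
      intro a
      refine (hrow a).resolve_left fun h1 => ?_
      have i0 : Function.Injective fun b => (f (a₀, b)).1 := fun b b' h =>
        congrArg Prod.snd (hf (Prod.ext h (h0 _ _)))
      have i1 : Function.Injective fun b => (f (a, b)).2 := fun b b' h =>
        congrArg Prod.snd (hf (Prod.ext (h1 _ _) h))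
      obtain ⟨b, hb⟩ := (i0.bijective_of_nat_card_le (by rw [hβ, hγ])).2 (f (a, b₀)).1
      obtain ⟨b', hb'⟩ := (i1.bijective_of_nat_card_le (by rw [hβ, hδ])).2 (f (a₀, b₀)).2
      have := hf (Prod.ext (hb.trans (h1 b₀ b')) ((h0 b b₀).trans hb'.symm))
      have e : a₀ = a := congrArg Prod.fst this
      subst e
      exact hne (h1 _ _)
    obtain ⟨u, v, hu, hv, h⟩ := exists_prod_map_of_rows (f := fun p => (f p).swap)
      (Prod.swap_bijective.comp hbij) (fun p q h => (hadj p q h).symm) hall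
    exact ⟨u, v, hu, hv, fun a b => by rw [← (f (a, b)).swap_swap, h a b]; rfl⟩

theorem exists_perm_of_injective {α : Type*} [Fintype α] [DecidableEq α] {S T : Finset α}
    {u : S → α} {v : ↥(Sᶜ) → α} (hu : Function.Injective u) (hv : Function.Injective v)
    (huT : ∀ z, u z ∈ T) (hvT : ∀ z, v z ∉ T) :
    ∃ π : Equiv.Perm α, (∀ z : S, π z.1 = u z) ∧ ∀ z : ↥(Sᶜ), π z.1 = v z := by
  have hinj : Function.Injective fun z =>
      if hz : z ∈ S then u ⟨z, hz⟩ else v ⟨z, mem_compl.2 hz⟩ := by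
    intro z w h
    by_cases hz : z ∈ S <;> by_cases hw : w ∈ S <;> simp only [hz, hw, dif_pos, dif_neg,
      not_false_eq_true] at h
    · exact congrArg Subtype.val (hu h)
    · exact absurd (huT ⟨z, hz⟩) (h ▸ hvT _)
    · exact absurd (huT ⟨w, hw⟩) (h ▸ hvT _)
    · exact congrArg Subtype.val (hv h)
  refine ⟨Equiv.ofBijective _ (Finite.injective_iff_bijective.1 hinj), fun z => ?_, fun z => ?_⟩
  · simp
  · simp [mem_compl.1 z.2]

theorem permVertex_perm_swap (π : Equiv.Perm (Fin (2 * m))) (x y : Fin (2 * m))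
    {P : QJVertex m} (h : permVertex π P = P) :
    permVertex π (permVertex (swap x y) P) = permVertex (swap (π x) (π y)) P := by
  rw [← Equiv.Perm.mul_apply, ← map_mul, Equiv.mul_swap_eq_swap_mul, map_mul,
    Equiv.Perm.mul_apply, h]

/-- An automorphism fixing a vertex agrees with some element of the symmetric group on that vertex
and on all of its neighbours. -/
theorem IsDigraphAut.exists_permVertex_eq_neighbors (hm : 4 ≤ m) {g : Equiv.Perm (QJVertex m)}
    (hg : IsDigraphAut (squashedJohnsonAdj m 1) g) {P : QJVertex m} (hP : g P = P) :
    ∃ π : Equiv.Perm (Fin (2 * m)), permVertex π P = P ∧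
      ∀ Q, squashedJohnsonAdj m 1 P Q → g Q = permVertex π Q := by
  obtain ⟨X, rfl⟩ := toVertex_surjective P
  have hex : ∀ p : X.1 × X.compl.1, ∃ q : X.1 × X.compl.1,
      g (permVertex (swap p.1.1 p.2.1) X.toVertex) =
        permVertex (swap q.1.1 q.2.1) X.toVertex := by
    rintro ⟨⟨x, hx⟩, y, hy⟩
    have := (hg _ _).1 (adj_toVertex_permVertex_swap (by omega) hx (mem_compl.1 hy))
    rw [hP] at this
    obtain ⟨x', hx', y', hy', h⟩ := exists_swap_of_adj this
    exact ⟨(⟨x', hx'⟩, ⟨y', mem_compl.2 hy'⟩), h.symm⟩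
  choose f hf using hex
  have hinj : Function.Injective f := by
    intro p q h
    have e : g (permVertex (swap p.1.1 p.2.1) X.toVertex) =
        g (permVertex (swap q.1.1 q.2.1) X.toVertex) := by rw [hf, hf, h]
    have := (permVertex_swap_eq_iff (by omega) p.1.2 (mem_compl.1 p.2.2) q.1.2
      (mem_compl.1 q.2.2)).1 (g.injective e)
    exact Prod.ext (Subtype.ext this.1) (Subtype.ext this.2)
  have hadj : ∀ p q, p.1 = q.1 ∨ p.2 = q.2 → (f p).1 = (f q).1 ∨ (f p).2 = (f q).2 := by
    intro p q h
    by_cases hpq : p = q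
    · exact Or.inl (by rw [hpq])
    · have h1 : squashedJohnsonAdj m 1 (permVertex (swap p.1.1 p.2.1) X.toVertex)
          (permVertex (swap q.1.1 q.2.1) X.toVertex) := by
        rw [adj_permVertex_swap_iff hm p.1.2 (mem_compl.1 p.2.2) q.1.2 (mem_compl.1 q.2.2)]
        have h2 : ¬ (p.1 = q.1 ∧ p.2 = q.2) := fun h => hpq (Prod.ext h.1 h.2)
        rw [Subtype.ext_iff, Subtype.ext_iff] at h h2
        tauto
      rw [hg, hf, hf, adj_permVertex_swap_iff hm (f p).1.2 (mem_compl.1 (f p).2.2) (f q).1.2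
        (mem_compl.1 (f q).2.2)] at h1
      rw [Subtype.ext_iff, Subtype.ext_iff]
      tauto
  have hcX : Nat.card X.1 = m := by rw [Nat.card_eq_fintype_card, Fintype.card_coe, X.2]
  have hcX' : Nat.card X.compl.1 = m := by
    rw [Nat.card_eq_fintype_card, Fintype.card_coe, X.compl.2]
  have : Nontrivial X.1 := Finite.one_lt_card_iff_nontrivial.1 (by omega)
  have hlift : ∃ π : Equiv.Perm (Fin (2 * m)), permVertex π X.toVertex = X.toVertex ∧
      ∀ p : X.1 × X.compl.1, g (permVertex (swap p.1.1 p.2.1) X.toVertex) =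
        permVertex (swap (π p.1.1) (π p.2.1)) X.toVertex := by
    have hfix : ∀ (π : Equiv.Perm (Fin (2 * m))) (Y : HalfSet m), (∀ z ∈ X.1, π z ∈ Y.1) →
        permVertex π X.toVertex = Y.toVertex := fun π Y h => by
      rw [permVertex_toVertex]
      congr 1
      refine Subtype.ext (eq_of_subset_of_card_le (fun z hz => ?_)
        (Y.2.trans (X.mapPerm π).2.symm).le)
      obtain ⟨w, hw, rfl⟩ := mem_map.1 hz
      exact h w hw
    rcases exists_prod_map_or_swap hinj (by omega) rfl (by omega) hadj with
      ⟨u, v, hu, hv, h⟩ | ⟨u, v, hu, hv, h⟩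
    · obtain ⟨π, h1, h2⟩ := exists_perm_of_injective (T := X.1)
        (Subtype.val_injective.comp hu) (Subtype.val_injective.comp hv)
        (fun z => (u z).2) (fun z => mem_compl.1 (v z).2)
      refine ⟨π, hfix π X fun z hz => ?_, fun p => ?_⟩
      · rw [h1 ⟨z, hz⟩]
        exact (u ⟨z, hz⟩).2
      · rw [hf, h1, show π p.2.1 = v p.2 from h2 p.2, h]
        rfl
    · obtain ⟨π, h1, h2⟩ := exists_perm_of_injective (T := X.1ᶜ)
        (Subtype.val_injective.comp hu) (Subtype.val_injective.comp hv)
        (fun z => (u z).2) (fun z => notMem_compl.2 (v z).2)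
      refine ⟨π, (hfix π X.compl fun z hz => ?_).trans X.toVertex_compl, fun p => ?_⟩
      · rw [h1 ⟨z, hz⟩]
        exact (u ⟨z, hz⟩).2
      · rw [hf, h1, show π p.2.1 = v p.2 from h2 p.2, h, Equiv.swap_comm]
        rfl
  obtain ⟨π, h1, h2⟩ := hlift
  refine ⟨π, h1, fun Q hQ => ?_⟩
  obtain ⟨x, hx, y, hy, rfl⟩ := exists_swap_of_adj hQ
  rw [permVertex_perm_swap π x y h1]
  exact h2 (⟨x, hx⟩, ⟨y, mem_compl.2 hy⟩)

/-- If an automorphism fixes a vertex and its neighbours, it fixes the vertices at distance two. -/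
theorem IsDigraphAut.fixes_neighbors_of_adj (hm : 4 ≤ m) {g : Equiv.Perm (QJVertex m)}
    (hg : IsDigraphAut (squashedJohnsonAdj m 1) g) {P Q : QJVertex m} (hP : g P = P)
    (hnb : ∀ R, squashedJohnsonAdj m 1 P R → g R = R) (hPQ : squashedJohnsonAdj m 1 P Q) :
    ∀ R, squashedJohnsonAdj m 1 Q R → g R = R := by
  intro R hR
  have hQ := hnb Q hPQ
  obtain ⟨X, rfl⟩ := toVertex_surjective Q
  obtain ⟨a, ha, b, hb, rfl⟩ := exists_swap_of_adj (squashedJohnsonAdj_symm hPQ)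
  obtain ⟨c, hc, d, hd, rfl⟩ := exists_swap_of_adj hR
  by_cases hac : a = c
  · by_cases hbd : b = d
    · rw [← hac, ← hbd, hP]
    · exact hnb _ ((adj_permVertex_swap_iff hm ha hb hc hd).2 (Or.inl ⟨hac, hbd⟩))
  by_cases hbd : b = d
  · exact hnb _ ((adj_permVertex_swap_iff hm ha hb hc hd).2 (Or.inr ⟨hac, hbd⟩))
  have f1 := hnb _ ((adj_permVertex_swap_iff hm ha hb ha hd).2 (Or.inl ⟨rfl, hbd⟩))
  have f2 := hnb _ ((adj_permVertex_swap_iff hm ha hb hc hb).2 (Or.inr ⟨hac, rfl⟩))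
  have a0 := (hg _ _).1 hR
  rw [hQ] at a0
  obtain ⟨c', hc', d', hd', h⟩ := exists_swap_of_adj a0
  have a1 := (hg _ _).1 ((adj_permVertex_swap_iff hm ha hd hc hd).2 (Or.inr ⟨hac, rfl⟩))
  have a2 := (hg _ _).1 ((adj_permVertex_swap_iff hm hc hb hc hd).2 (Or.inl ⟨rfl, hbd⟩))
  rw [f1, ← h, adj_permVertex_swap_iff hm ha hd hc' hd'] at a1
  rw [f2, ← h, adj_permVertex_swap_iff hm hc hb hc' hd'] at a2
  have hne : ¬ (a = c' ∧ b = d') := by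
    rintro ⟨rfl, rfl⟩
    rw [← hP] at h
    exact hac ((permVertex_swap_eq_iff (by omega) ha hb hc hd).1 (g.injective h)).1
  rw [← h]
  grind

theorem IsDigraphAut.eq_one_of_fixes_neighbors (hm : 4 ≤ m) {g : Equiv.Perm (QJVertex m)}
    (hg : IsDigraphAut (squashedJohnsonAdj m 1) g) {P : QJVertex m} (hP : g P = P)
    (hnb : ∀ R, squashedJohnsonAdj m 1 P R → g R = R) : g = 1 := by
  have key : ∀ σ : Equiv.Perm (Fin (2 * m)), g (permVertex σ P) = permVertex σ P ∧
      ∀ R, squashedJohnsonAdj m 1 (permVertex σ P) R → g R = R := by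
    intro σ
    induction σ using Equiv.Perm.swap_induction_on with
    | one => simpa using ⟨hP, hnb⟩
    | swap_mul f x y hxy ih =>
      rw [map_mul, Equiv.Perm.mul_apply]
      generalize permVertex f P = Q at ih ⊢
      have step : ∀ R, squashedJohnsonAdj m 1 Q R →
          g R = R ∧ ∀ S, squashedJohnsonAdj m 1 R S → g S = S := fun R hR =>
        ⟨ih.2 R hR, hg.fixes_neighbors_of_adj hm ih.1 ih.2 hR⟩
      obtain ⟨X, rfl⟩ := toVertex_surjective Q
      by_cases hx : x ∈ X.1 <;> by_cases hy : y ∈ X.1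
      · rw [permVertex_swap_eq (by tauto)]; exact ih
      · exact step _ (adj_toVertex_permVertex_swap (by omega) hx hy)
      · rw [Equiv.swap_comm]
        exact step _ (adj_toVertex_permVertex_swap (by omega) hy hx)
      · rw [permVertex_swap_eq (by tauto)]; exact ih
  ext Q
  obtain ⟨σ, rfl⟩ := exists_permVertex_eq P Q
  exact (key σ).1

/-- An automorphism with a fixed vertex is induced by a permutation of the underlying set. -/
theorem IsDigraphAut.exists_eq_permVertex (hm : 4 ≤ m) {g : Equiv.Perm (QJVertex m)}
    (hg : IsDigraphAut (squashedJohnsonAdj m 1) g) {P : QJVertex m} (hP : g P = P) :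
    ∃ σ : Equiv.Perm (Fin (2 * m)), g = permVertex σ := by
  obtain ⟨π, hπ, h⟩ := hg.exists_permVertex_eq_neighbors hm hP
  have hinv : ∀ R, permVertex π⁻¹ (permVertex π R) = R := fun R => by
    rw [← Equiv.Perm.mul_apply, ← map_mul, inv_mul_cancel, map_one, Equiv.Perm.one_apply]
  have hg' : IsDigraphAut (squashedJohnsonAdj m 1) (permVertex π⁻¹ * g) := fun u v =>
    (hg u v).trans (isDigraphAut_permVertex 1 π⁻¹ _ _)
  have := hg'.eq_one_of_fixes_neighbors hm (P := P)
    (by rw [Equiv.Perm.mul_apply, hP]; nth_rw 1 [← hπ]; exact hinv P)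
    (fun R hR => by rw [Equiv.Perm.mul_apply, h R hR, hinv])
  refine ⟨π, ?_⟩
  rw [map_inv] at this
  exact (inv_mul_eq_one.1 this).symm

open Classical in
theorem natCard_vertex_eq_card_filter (a : Fin (2 * m)) (p : QJVertex m → Prop) :
    Nat.card {P : QJVertex m // p P} =
      ((univ : Finset (HalfSet m)).filter (fun X => a ∈ X.1 ∧ p X.toVertex)).card := by
  rw [← Fintype.card_subtype, ← Nat.card_eq_fintype_card]
  symm
  refine Nat.card_congr (Equiv.ofBijective (fun X => ⟨X.1.toVertex, X.2.2⟩) ⟨?_, ?_⟩)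
  · rintro ⟨X, hX, _⟩ ⟨Y, hY, _⟩ h
    rcases toVertex_eq_iff.1 (Subtype.mk.inj h) with e | e
    · exact Subtype.ext (Subtype.ext e.symm)
    · rw [e] at hY
      exact absurd hX (mem_compl.1 hY)
  · rintro ⟨P, hP⟩
    obtain ⟨X, rfl⟩ := toVertex_surjective P
    by_cases ha : a ∈ X.1
    · exact ⟨⟨X, ha, hP⟩, rfl⟩
    · exact ⟨⟨X.compl, mem_compl.2 ha, X.toVertex_compl ▸ hP⟩, Subtype.ext X.toVertex_compl⟩

theorem HalfSet.card_filter_subset (T : Finset (Fin (2 * m))) (hT : T.card ≤ m) :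
    ((univ : Finset (HalfSet m)).filter (fun X => T ⊆ X.1)).card =
      (2 * m - T.card).choose (m - T.card) := by
  have hc : Tᶜ.card = 2 * m - T.card := by rw [card_compl, Fintype.card_fin]
  rw [← hc, ← card_powersetCard]
  refine card_bij (fun X _ => X.1 \ T) ?_ ?_ ?_
  · intro X hX
    rw [mem_filter] at hX
    rw [mem_powersetCard, card_sdiff_of_subset hX.2, X.2]
    exact ⟨fun z hz => mem_compl.2 (mem_sdiff.1 hz).2, rfl⟩
  · intro X hX Y hY h
    rw [mem_filter] at hX hY
    refine Subtype.ext ?_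
    rw [← sdiff_union_of_subset hX.2, h, sdiff_union_of_subset hY.2]
  · intro U hU
    rw [mem_powersetCard] at hU
    have hd : Disjoint U T := disjoint_left.2 fun z hz => mem_compl.1 (hU.1 hz)
    refine ⟨⟨U ∪ T, by rw [card_union_of_disjoint hd]; omega⟩, ?_, ?_⟩
    · simp
    · exact union_sdiff_cancel_right hd

theorem HalfSet.card_filter_mem_mem (hm : 2 ≤ m) {a b : Fin (2 * m)} (hab : a ≠ b) :
    ((univ : Finset (HalfSet m)).filter (fun X => a ∈ X.1 ∧ b ∈ X.1)).card =
      (2 * m - 2).choose (m - 2) := by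
  have := HalfSet.card_filter_subset {a, b} (by rwa [card_pair hab])
  rw [card_pair hab] at this
  simpa [insert_subset_iff] using this

theorem natCard_vertex (hm : 1 ≤ m) :
    Nat.card (QJVertex m) = (2 * m - 1).choose (m - 1) := by
  have a : Fin (2 * m) := ⟨0, by omega⟩
  have h := natCard_vertex_eq_card_filter a (fun _ => True)
  have := HalfSet.card_filter_subset {a} (by rwa [card_singleton])
  rw [card_singleton] at this
  rw [← this, ← Nat.card_congr (Equiv.subtypeUnivEquiv (p := fun _ : QJVertex m => True)
    fun _ => trivial), h]
  simp

theorem permVertex_toVertex_eq_iff {σ : Equiv.Perm (Fin (2 * m))} {X : HalfSet m} :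
    permVertex σ X.toVertex = X.toVertex ↔
      (∀ z, σ z ∈ X.1 ↔ z ∈ X.1) ∨ (∀ z, σ z ∈ X.1 ↔ z ∉ X.1) := by
  rw [permVertex_toVertex, toVertex_eq_iff]
  refine or_congr ?_ ?_ <;> rw [Finset.ext_iff, ← σ.forall_congr_right] <;>
    simp [mem_mapPerm]

/-- If every fixed vertex has `a` and `b` in the same block, there are few fixed vertices. -/
theorem natCard_fixed_le_of_mem (hm : 2 ≤ m) {σ : Equiv.Perm (Fin (2 * m))} {a b : Fin (2 * m)}
    (hab : a ≠ b) (h : ∀ X : HalfSet m, permVertex σ X.toVertex = X.toVertex → a ∈ X.1 →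
      b ∈ X.1) :
    Nat.card {P : QJVertex m // permVertex σ P = P} ≤ (2 * m - 2).choose (m - 2) := by
  rw [natCard_vertex_eq_card_filter a, ← card_filter_mem_mem hm hab]
  refine card_le_card fun X hX => ?_
  simp only [mem_filter, mem_univ, true_and] at hX ⊢
  exact ⟨hX.1, h X hX.2 hX.1⟩

theorem natCard_fixed_le_of_involution (hm : 3 ≤ m) {σ : Equiv.Perm (Fin (2 * m))}
    (hinv : ∀ z, σ (σ z) = z) (hfree : ∀ z, σ z ≠ z) :
    Nat.card {P : QJVertex m // permVertex σ P = P} ≤ (2 * m - 2).choose (m - 2) := by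
  classical
  have a : Fin (2 * m) := ⟨0, by omega⟩
  have hnot : ∀ T : Finset (Fin (2 * m)), T.card < 2 * m → ∃ z, z ∉ T := fun T hT => by
    by_contra! hc
    rw [eq_univ_iff_forall.2 hc, card_univ, Fintype.card_fin] at hT
    exact lt_irrefl _ hT
  obtain ⟨b, hb⟩ : ∃ b, b = σ a := ⟨_, rfl⟩
  obtain ⟨c, hc⟩ := hnot {a, b} (card_le_two.trans_lt (by omega))
  obtain ⟨d, hd⟩ : ∃ d, d = σ c := ⟨_, rfl⟩
  obtain ⟨e, he⟩ := hnot {a, b, c, d} (card_le_four.trans_lt (by omega))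
  obtain ⟨f, hf⟩ : ∃ f, f = σ e := ⟨_, rfl⟩
  have hdist : [a, b, c, d, e, f].Nodup := by
    have := hfree a; have := hfree c; have := hfree e
    have := hinv a; have := hinv c; have := hinv e
    have := hinv b; have := hinv d; have := hinv f
    simp only [mem_insert, mem_singleton, not_or] at hc he
    grind
  have hab : a ≠ b := hb ▸ (hfree a).symm
  rw [natCard_vertex_eq_card_filter a, ← card_filter_mem_mem (by omega) hab]
  let Ψ : HalfSet m → HalfSet m := fun X =>
    if b ∈ X.1 then X else if c ∈ X.1 then X.mapPerm (swap b c) else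
      if e ∈ X.1 then X.mapPerm (swap b e) else (X.mapPerm (swap c f)).mapPerm (swap b d)
  let Φ : HalfSet m → HalfSet m := fun X =>
    if c ∈ X.1 ∧ d ∉ X.1 then (X.mapPerm (swap b d)).mapPerm (swap c f) else
      if c ∉ X.1 ∧ d ∈ X.1 then X.mapPerm (swap b e) else
        if e ∈ X.1 ↔ f ∈ X.1 then X else X.mapPerm (swap b c)
  have hswap : ∀ (x y : Fin (2 * m)) (X : HalfSet m),
      (X.mapPerm (swap x y)).mapPerm (swap x y) = X := fun x y X => by
    rw [← mapPerm_mul, Equiv.swap_mul_self, mapPerm_one]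
  have main : ∀ X : HalfSet m, a ∈ X.1 → permVertex σ X.toVertex = X.toVertex →
      (a ∈ (Ψ X).1 ∧ b ∈ (Ψ X).1) ∧ Φ (Ψ X) = X := by
    intro X ha hX
    rw [permVertex_toVertex_eq_iff] at hX
    have hmem : ∀ (x y z : Fin (2 * m)) (X : HalfSet m),
        z ∈ (X.mapPerm (swap x y)).1 ↔ (if z = x then y else if z = y then x else z) ∈ X.1 :=
      fun x y z X => by rw [mem_mapPerm, Equiv.symm_swap, swap_apply_def]
    have hXa : b ∈ X.1 ∧ (d ∈ X.1 ↔ c ∈ X.1) ∧ (f ∈ X.1 ↔ e ∈ X.1) ∨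
        b ∉ X.1 ∧ (d ∈ X.1 ↔ c ∉ X.1) ∧ (f ∈ X.1 ↔ e ∉ X.1) := by
      rw [hb, hd, hf]
      rcases hX with h | h
      · exact Or.inl ⟨(h a).2 ha, h c, h e⟩
      · exact Or.inr ⟨fun hh => (h a).1 hh ha, h c, h e⟩
    clear hX
    simp only [List.nodup_cons, List.mem_cons, not_or, List.not_mem_nil] at hdist
    by_cases hbX : b ∈ X.1
    · have e1 : Ψ X = X := if_pos hbX
      rw [e1]
      refine ⟨⟨ha, hbX⟩, ?_⟩
      simp only [Φ]
      rw [if_neg (by tauto), if_neg (by tauto), if_pos (by tauto)]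
    by_cases hcX : c ∈ X.1
    · have e1 : Ψ X = X.mapPerm (swap b c) := by simp only [Ψ, if_neg hbX, if_pos hcX]
      rw [e1]
      have hc' : c ∉ (X.mapPerm (swap b c)).1 := by rw [hmem]; grind
      have hd' : d ∉ (X.mapPerm (swap b c)).1 := by rw [hmem]; grind
      have he' : ¬ (e ∈ (X.mapPerm (swap b c)).1 ↔ f ∈ (X.mapPerm (swap b c)).1) := by
        rw [hmem, hmem]; grind
      refine ⟨⟨by rw [hmem]; grind, by rw [hmem]; grind⟩, ?_⟩
      simp only [Φ]
      rw [if_neg (by tauto), if_neg (by tauto), if_neg he', hswap]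
    by_cases heX : e ∈ X.1
    · have e1 : Ψ X = X.mapPerm (swap b e) := by
        simp only [Ψ, if_neg hbX, if_neg hcX, if_pos heX]
      rw [e1]
      have hc' : c ∉ (X.mapPerm (swap b e)).1 := by rw [hmem]; grind
      have hd' : d ∈ (X.mapPerm (swap b e)).1 := by rw [hmem]; grind
      refine ⟨⟨by rw [hmem]; grind, by rw [hmem]; grind⟩, ?_⟩
      simp only [Φ]
      rw [if_neg (by tauto), if_pos (by tauto), hswap]
    · have e1 : Ψ X = (X.mapPerm (swap c f)).mapPerm (swap b d) := by
        simp only [Ψ, if_neg hbX, if_neg hcX, if_neg heX]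
      rw [e1]
      have hc' : c ∈ ((X.mapPerm (swap c f)).mapPerm (swap b d)).1 := by rw [hmem, hmem]; grind
      have hd' : d ∉ ((X.mapPerm (swap c f)).mapPerm (swap b d)).1 := by rw [hmem, hmem]; grind
      refine ⟨⟨by rw [hmem, hmem]; grind, by rw [hmem, hmem]; grind⟩, ?_⟩
      simp only [Φ]
      rw [if_pos (by tauto), hswap, hswap]
  refine card_le_card_of_injOn Ψ (fun X hX => ?_) (Set.LeftInvOn.injOn (f₁' := Φ) fun X hX => ?_)
  · simp only [mem_coe, mem_filter, mem_univ, true_and] at hX ⊢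
    exact (main X hX.1 hX.2).1
  · simp only [mem_coe, mem_filter, mem_univ, true_and] at hX
    exact (main X hX.1 hX.2).2

theorem natCard_fixed_permVertex_le (hm : 3 ≤ m) {σ : Equiv.Perm (Fin (2 * m))} (hσ : σ ≠ 1) :
    Nat.card {P : QJVertex m // permVertex σ P = P} ≤ (2 * m - 2).choose (m - 2) := by
  by_cases hinv : ∀ z, σ (σ z) = z
  · by_cases hfree : ∀ z, σ z ≠ z
    · exact natCard_fixed_le_of_involution hm hinv hfree
    · push Not at hfree
      obtain ⟨w, hw⟩ := hfree
      obtain ⟨a, ha⟩ : ∃ a, σ a ≠ a := by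
        by_contra! hc
        exact hσ (Equiv.ext hc)
      refine natCard_fixed_le_of_mem (by omega) ha.symm fun X hX haX => ?_
      rcases permVertex_toVertex_eq_iff.1 hX with h | h
      · exact (h a).2 haX
      · have := h w
        rw [hw] at this
        tauto
  · push Not at hinv
    obtain ⟨a, ha⟩ := hinv
    refine natCard_fixed_le_of_mem (by omega) ha.symm fun X hX haX => ?_
    rcases permVertex_toVertex_eq_iff.1 hX with h | h
    · rwa [h, h]
    · rw [h, h]
      tauto

theorem natCard_fixed_swap (hm : 3 ≤ m) {a b : Fin (2 * m)} (hab : a ≠ b) :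
    Nat.card {P : QJVertex m // permVertex (swap a b) P = P} = (2 * m - 2).choose (m - 2) := by
  refine le_antisymm (natCard_fixed_permVertex_le hm ?_) ?_
  · rwa [ne_eq, Equiv.Perm.one_def, Equiv.swap_eq_refl_iff]
  · rw [natCard_vertex_eq_card_filter a, ← card_filter_mem_mem (by omega) hab]
    refine card_le_card fun X hX => ?_
    simp only [mem_filter, mem_univ, true_and] at hX ⊢
    exact ⟨hX.1, permVertex_swap_eq (by tauto)⟩

theorem choose_mul_eq_choose_mul (hm : 2 ≤ m) :
    (2 * m - 2).choose (m - 2) * (2 * m - 1) = (2 * m - 1).choose (m - 1) * (m - 1) := by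
  obtain ⟨k, rfl⟩ := Nat.exists_eq_add_of_le hm
  rw [show 2 * (2 + k) - 2 = 2 * k + 2 by omega, show 2 * (2 + k) - 1 = 2 * k + 2 + 1 by omega,
    show 2 + k - 2 = k by omega, show 2 + k - 1 = k + 1 by omega,
    ← Nat.add_one_mul_choose_eq, mul_comm]

theorem digraphFixity_squashedJohnsonAdj (hi : 1 ≤ i) (him : 2 * i + 2 ≤ m) :
    digraphFixity (squashedJohnsonAdj m i) = (2 * m - 2).choose (m - 2) := by
  have hm : 4 ≤ m := by omega
  refine IsGreatest.csSup_eq ⟨?_, ?_⟩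
  · have hab : (⟨0, by omega⟩ : Fin (2 * m)) ≠ ⟨1, by omega⟩ := by simp
    refine ⟨permVertex (swap ⟨0, by omega⟩ ⟨1, by omega⟩),
      ⟨isDigraphAut_permVertex i _, fun h => ?_⟩, natCard_fixed_swap (by omega) hab⟩
    have h1 := natCard_fixed_swap (by omega) hab
    have h2 := natCard_vertex (m := m) (by omega)
    rw [h, Nat.card_congr (Equiv.subtypeUnivEquiv
      (p := fun P => (1 : Equiv.Perm (QJVertex m)) P = P) fun _ => rfl), h2] at h1
    have h3 := choose_mul_eq_choose_mul (m := m) (by omega)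
    rw [h1] at h3
    have h4 := Nat.choose_pos (n := 2 * m - 2) (k := m - 2) (by omega)
    have := Nat.eq_of_mul_eq_mul_left h4 h3
    omega
  · rintro _ ⟨g, ⟨hg, hne⟩, rfl⟩
    rcases isEmpty_or_nonempty {P // g P = P} with he | ⟨P, hP⟩
    · simp
    · obtain ⟨σ, rfl⟩ := (hg.squashedJohnsonAdj_one hi him).exists_eq_permVertex hm hP
      exact natCard_fixed_permVertex_le (by omega) fun h => hne (by rw [h, map_one])

end SquashedJohnson

/-- Let m and i be positive integers with m ≥ 3, i ≤ ⌊m/2⌋ and i ≠ ⌊m/2⌋.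
Then the relative fixity of the squashed distance-i Johnson graph QJ(2m,m,i) equals
(1/2)·(1 − 1/(2m−1)) = (m−1)/(2m−1). -/
theorem stmt_8 (m i : ℕ) (hm : 3 ≤ m) (hi : 0 < i) (hile : i ≤ m / 2) (hine : i ≠ m / 2) :
    (digraphFixity (squashedJohnsonAdj m i) : ℝ) / Nat.card (QJVertex m)
      = (1 / 2) * (1 - 1 / (2 * (m : ℝ) - 1)) := by
  rw [digraphFixity_squashedJohnsonAdj hi (by omega), natCard_vertex (by omega)]
  have h := congrArg (Nat.cast (R := ℝ)) (choose_mul_eq_choose_mul (m := m) (by omega))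
  push_cast [show 1 ≤ 2 * m by omega, show 1 ≤ m by omega] at h
  have h1 : ((2 * m - 1).choose (m - 1) : ℝ) ≠ 0 :=
    Nat.cast_ne_zero.2 (Nat.choose_pos (by omega)).ne'
  have h2 : (2 * (m : ℝ) - 1) ≠ 0 := by
    have : (3 : ℝ) ≤ m := by exact_mod_cast hm
    linarith
  have h3 : (1 / 2) * (1 - 1 / (2 * (m : ℝ) - 1)) = ((m : ℝ) - 1) / (2 * m - 1) := by
    field_simp
    ring
  rw [h3, div_eq_div_iff h1 h2, h, mul_comm]
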